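/- arXiv:1408.5825 — 9 statements merged into one kernel-verified Lean document; each statement's English description precedes it below -/
import Mathlib

section
/- Let T ≥ 1 and let p = (p_1,…,p_T) be a supply profile with p_1 ≥ p_2 ≥ … ≥ p_T ≥ 0. Let (ℓ, h) be loads with demand profile d = (d_1,…,d_T). If p is majorized by d, i.e. ∑_{t=1}^{s} p_t ≤ ∑_{t=1}^{s} d_t for s = 1,…,T−1 and ∑_{t=1}^{T} p_t = ∑_{t=1}^{T} d_t, then p is exactly adequate for the loads (ℓ, h). (Sufficiency direction of Theorem 1.) -/
open MeasureTheory

/-- The demand profile of loads `(ℓ, h)`: `d_t = ∫_0^1 ℓ(x) 1{h(x) ≥ t} dx`. -/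
noncomputable def demandProfile (ℓ : ℝ → ℝ) (h : ℝ → ℕ) (t : ℕ) : ℝ :=
  ∫ x in Set.Icc (0 : ℝ) 1, ℓ x * (if t ≤ h x then (1 : ℝ) else 0)

/-- A supply profile `p` is exactly adequate for loads `(ℓ, h)` if there is a
measurable `{0,1}`-valued allocation `A` with `∫_0^1 ℓ(x) A(x,t) dx = p_t` for
every slot `t ∈ {1,…,T}` and `∑_{t=1}^T A(x,t) = h(x)` for a.e. `x ∈ [0,1]`. -/
def ExactlyAdequate (T : ℕ) (ℓ : ℝ → ℝ) (h : ℝ → ℕ) (p : ℕ → ℝ) : Prop :=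
  ∃ A : ℝ → ℕ → ℝ,
    (∀ t : ℕ, Measurable fun x => A x t) ∧
    (∀ x : ℝ, ∀ t : ℕ, A x t = 0 ∨ A x t = 1) ∧
    (∀ t ∈ Finset.Icc 1 T, (∫ x in Set.Icc (0 : ℝ) 1, ℓ x * A x t) = p t) ∧
    (∀ᵐ x ∂(volume.restrict (Set.Icc (0 : ℝ) 1)),
      ∑ t ∈ Finset.Icc 1 T, A x t = (h x : ℝ))


lemma adequate_congr {T : ℕ} {ℓ : ℝ → ℝ} {h : ℝ → ℕ} {p q : ℕ → ℝ}
    (hq : ExactlyAdequate T ℓ h q) (hpq : ∀ t ∈ Finset.Icc 1 T, q t = p t) :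
    ExactlyAdequate T ℓ h p := by
  obtain ⟨A, h1, h2, h3, h4⟩ := hq
  exact ⟨A, h1, h2, fun t ht => (h3 t ht).trans (hpq t ht), h4⟩

/-- The part of a nonnegative integrable load to the left of a threshold takes every value. -/
lemma exists_threshold (g : ℝ → ℝ) (hg : IntegrableOn g (Set.Icc (0 : ℝ) 1)) (δ : ℝ)
    (h0 : 0 ≤ δ) (h1 : δ ≤ ∫ x in Set.Icc (0 : ℝ) 1, g x) :
    ∃ y : ℝ, (∫ x in Set.Icc (0 : ℝ) 1, (if x ≤ y then g x else 0)) = δ := by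
  have hc : ContinuousOn (fun y => ∫ x in Set.Ioc (0 : ℝ) y, g x) (Set.Icc 0 1) :=
    intervalIntegral.continuousOn_primitive hg
  have hiv := intermediate_value_Icc (zero_le_one' ℝ) hc
  have hmem : δ ∈ Set.Icc (∫ x in Set.Ioc (0 : ℝ) 0, g x) (∫ x in Set.Ioc (0 : ℝ) 1, g x) := by
    refine ⟨by simpa using h0, ?_⟩
    rwa [← integral_Icc_eq_integral_Ioc]
  obtain ⟨y, hy, hyd⟩ := hiv hmem
  refine ⟨y, ?_⟩
  rw [← hyd]
  have : (fun x => if x ≤ y then g x else 0) = (Set.Iic y).indicator g := by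
    ext x; simp [Set.indicator]
  rw [this, setIntegral_indicator measurableSet_Iic]
  have : Set.Icc (0 : ℝ) 1 ∩ Set.Iic y = Set.Icc 0 y := by
    ext x
    simp only [Set.mem_inter_iff, Set.mem_Icc, Set.mem_Iic]
    constructor
    · rintro ⟨⟨a, b⟩, c⟩; exact ⟨a, c⟩
    · rintro ⟨a, b⟩; exact ⟨⟨a, b.trans hy.2⟩, b⟩
  rw [this, integral_Icc_eq_integral_Ioc]

lemma integrable_load {ℓ f : ℝ → ℝ} (hℓint : IntegrableOn ℓ (Set.Icc (0 : ℝ) 1))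
    (hf : Measurable f) (h01 : ∀ x, f x = 0 ∨ f x = 1) :
    IntegrableOn (fun x => ℓ x * f x) (Set.Icc (0 : ℝ) 1) := by
  refine Integrable.mul_bdd (c := 1) hℓint hf.aestronglyMeasurable ?_
  refine Filter.Eventually.of_forall fun x => ?_
  rcases h01 x with h | h <;> simp [h]

/-- Moving an amount `δ ≤ q i - q j` of power from slot `i` to slot `j` keeps adequacy. -/
lemma adequate_transfer {T : ℕ} {ℓ : ℝ → ℝ} {h : ℝ → ℕ} {q : ℕ → ℝ}
    (hℓnonneg : ∀ x, 0 ≤ ℓ x)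
    (hℓint : IntegrableOn ℓ (Set.Icc (0 : ℝ) 1))
    (hq : ExactlyAdequate T ℓ h q) {i j : ℕ} (hi : i ∈ Finset.Icc 1 T)
    (hj : j ∈ Finset.Icc 1 T) (hij : i ≠ j) {δ : ℝ} (h0 : 0 ≤ δ) (hδ : δ ≤ q i - q j) :
    ExactlyAdequate T ℓ h
      (fun t => q t - (if t = i then δ else 0) + (if t = j then δ else 0)) := by
  obtain ⟨A, hm, h01, hA, hs⟩ := hq
  have hD01 : ∀ x, A x i * (1 - A x j) = 0 ∨ A x i * (1 - A x j) = 1 := by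
    intro x
    rcases h01 x i with a | a <;> rcases h01 x j with b | b <;> simp [a, b]
  have hDm : Measurable fun x => A x i * (1 - A x j) := (hm i).mul ((hm j).const_sub 1)
  have hDint := integrable_load hℓint hDm hD01
  have hAint : ∀ t, IntegrableOn (fun x => ℓ x * A x t) (Set.Icc (0 : ℝ) 1) := fun t =>
    integrable_load hℓint (hm t) (fun x => h01 x t)
  have hle : δ ≤ ∫ x in Set.Icc (0 : ℝ) 1, ℓ x * (A x i * (1 - A x j)) := by
    refine hδ.trans ?_
    rw [← hA i hi, ← hA j hj, ← integral_sub (hAint i) (hAint j)]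
    refine integral_mono ((hAint i).sub (hAint j)) hDint fun x => ?_
    have := hℓnonneg x
    rcases h01 x i with a | a <;> rcases h01 x j with b | b <;> simp [a, b, this]
  obtain ⟨y, hy⟩ := exists_threshold _ hDint δ h0 hle
  let B : ℝ → ℝ := fun x => if x ≤ y then A x i * (1 - A x j) else 0
  have hB01 : ∀ x, B x = 0 ∨ B x = 1 := by
    intro x
    by_cases hx : x ≤ y
    · simpa only [B, hx, if_true] using hD01 x
    · simp [B, hx]
  have hBm : Measurable B := Measurable.ite measurableSet_Iic hDm measurable_const
  have hBint := integrable_load hℓint hBm hB01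
  have hB : ∫ x in Set.Icc (0 : ℝ) 1, ℓ x * B x = δ := by
    rw [← hy]
    refine integral_congr_ae (Filter.Eventually.of_forall fun x => ?_)
    simp only [B, mul_ite, mul_zero]
  have hji : j ≠ i := hij.symm
  refine ⟨fun x t => A x t - (if t = i then B x else 0) + (if t = j then B x else 0),
    ?_, ?_, ?_, ?_⟩
  · intro t
    by_cases a : t = i <;> by_cases b : t = j <;> simp only [a, b, hij, hji, if_true, if_false] <;>
      fun_prop
  · intro x t
    by_cases a : t = i
    · subst a
      by_cases hx : x ≤ y <;> rcases h01 x t with a | a <;> rcases h01 x j with b | b <;>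
        simp [B, a, b, hij, hx]
    · by_cases b : t = j
      · subst b
        by_cases hx : x ≤ y <;> rcases h01 x i with a | a <;> rcases h01 x t with b | b <;>
          simp [B, a, b, hji, hx]
      · simpa [a, b] using h01 x t
  · intro t ht
    by_cases a : t = i
    · subst a
      simp only [if_true, hij, if_false, add_zero, mul_sub]
      rw [integral_sub (hAint t) hBint, hB, hA t ht]
    · by_cases b : t = j
      · subst b
        simp only [if_true, hji, if_false, sub_zero, mul_add]
        rw [integral_add (hAint t) hBint, hB, hA t ht]
      · simpa [a, b] using hA t ht
  · filter_upwards [hs] with x hx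
    rw [Finset.sum_add_distrib, Finset.sum_sub_distrib, Finset.sum_ite_eq', Finset.sum_ite_eq',
      if_pos hi, if_pos hj, hx]
    ring

lemma majorization_induction (T : ℕ) (p : ℕ → ℝ) (P : (ℕ → ℝ) → Prop)
    (hpmono : ∀ s t : ℕ, 1 ≤ s → s ≤ t → t ≤ T → p t ≤ p s)
    (hcongr : ∀ q, P q → (∀ t ∈ Finset.Icc 1 T, q t = p t) → P p)
    (htrans : ∀ q, P q → ∀ i ∈ Finset.Icc 1 T, ∀ j ∈ Finset.Icc 1 T, i ≠ j → ∀ δ : ℝ,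
      0 ≤ δ → δ ≤ q i - q j →
      P (fun t => q t - (if t = i then δ else 0) + (if t = j then δ else 0))) :
    ∀ (n : ℕ) (q : ℕ → ℝ), ((Finset.Icc 1 T).filter fun t => q t ≠ p t).card ≤ n → P q →
      (∀ s ≤ T, 0 ≤ ∑ t ∈ Finset.Icc 1 s, (q t - p t)) →
      ∑ t ∈ Finset.Icc 1 T, (q t - p t) = 0 → P p := by
  intro n
  induction n with
  | zero =>
    intro q hn hq _ _
    refine hcongr q hq fun t ht => ?_
    by_contra hne
    have : t ∈ (Finset.Icc 1 T).filter fun t => q t ≠ p t := Finset.mem_filter.2 ⟨ht, hne⟩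
    rw [Finset.card_eq_zero.1 (Nat.le_zero.1 hn)] at this
    simp at this
  | succ n ih =>
    intro q hn hq hpre htot
    by_cases hall : ∀ t ∈ Finset.Icc 1 T, 0 ≤ q t - p t
    · refine hcongr q hq fun t ht => ?_
      have := (Finset.sum_eq_zero_iff_of_nonneg hall).1 htot t ht
      linarith
    have hex : ∃ j, j ∈ Finset.Icc 1 T ∧ q j - p j < 0 := by
      push Not at hall
      obtain ⟨j, hj, hj'⟩ := hall
      exact ⟨j, hj, hj'⟩
    classical
    obtain ⟨hjm, hjneg⟩ := Nat.find_spec hex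
    have hjmin := fun t (ht : t < Nat.find hex) => Nat.find_min hex ht
    generalize Nat.find hex = j at hjm hjneg hjmin
    obtain ⟨hj1, hjT⟩ := Finset.mem_Icc.1 hjm
    obtain ⟨k, rfl⟩ : ∃ k, j = k + 1 := ⟨j - 1, by omega⟩
    have hnn : ∀ t, 1 ≤ t → t ≤ k → 0 ≤ q t - p t := by
      intro t h1 h2
      by_contra hlt
      exact hjmin t (by omega) ⟨Finset.mem_Icc.2 ⟨h1, by omega⟩, not_le.1 hlt⟩
    have hQk : -(q (k + 1) - p (k + 1)) ≤ ∑ t ∈ Finset.Icc 1 k, (q t - p t) := by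
      have := hpre (k + 1) hjT
      rw [Finset.sum_Icc_succ_top (by omega)] at this
      linarith
    let S := (Finset.Icc 1 k).filter fun t => 0 < q t - p t
    have hS : S.Nonempty := by
      by_contra hne
      have hz : ∑ t ∈ Finset.Icc 1 k, (q t - p t) ≤ 0 := by
        refine Finset.sum_nonpos fun t ht => ?_
        by_contra hlt
        exact hne ⟨t, Finset.mem_filter.2 ⟨ht, not_le.1 hlt⟩⟩
      linarith
    obtain ⟨hiI, hipos⟩ := Finset.mem_filter.1 (S.max'_mem hS)
    have himax : ∀ t ∈ S, t ≤ S.max' hS := fun t ht => S.le_max' t ht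
    generalize S.max' hS = i at hiI hipos himax
    obtain ⟨hi1, hik⟩ := Finset.mem_Icc.1 hiI
    have hzero : ∀ t, i < t → t ≤ k → q t - p t = 0 := by
      intro t h1 h2
      refine le_antisymm ?_ (hnn t (by omega) h2)
      by_contra hlt
      have := himax t (Finset.mem_filter.2 ⟨Finset.mem_Icc.2 ⟨by omega, h2⟩, not_le.1 hlt⟩)
      omega
    have hiT : i ∈ Finset.Icc 1 T := Finset.mem_Icc.2 ⟨hi1, by omega⟩
    have hij : i ≠ k + 1 := by omega
    have hp := hpmono i (k + 1) hi1 (by omega) hjT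
    obtain ⟨δ, hδd⟩ : ∃ δ, δ = min (q i - p i) (-(q (k + 1) - p (k + 1))) := ⟨_, rfl⟩
    have hδ1 : δ ≤ q i - p i := hδd ▸ min_le_left _ _
    have hδ2 : δ ≤ -(q (k + 1) - p (k + 1)) := hδd ▸ min_le_right _ _
    have hδ0 : 0 < δ := by rw [hδd]; exact lt_min hipos (by linarith)
    have hsum : ∀ s, ∑ t ∈ Finset.Icc 1 s,
        (q t - (if t = i then δ else 0) + (if t = k + 1 then δ else 0) - p t)
        = ∑ t ∈ Finset.Icc 1 s, (q t - p t) - (if i ≤ s then δ else 0)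
          + (if k + 1 ≤ s then δ else 0) := by
      intro s
      have : ∀ t, (q t - (if t = i then δ else 0) + (if t = k + 1 then δ else 0) - p t)
        = (q t - p t) - (if t = i then δ else 0) + (if t = k + 1 then δ else 0) := by
        intro t; ring
      simp only [this]
      rw [Finset.sum_add_distrib, Finset.sum_sub_distrib, Finset.sum_ite_eq', Finset.sum_ite_eq']
      simp [hi1]
    refine ih (fun t => q t - (if t = i then δ else 0) + (if t = k + 1 then δ else 0)) ?_
      (htrans q hq i hiT (k + 1) hjm hij δ hδ0.le (by linarith)) ?_ ?_
    · refine Nat.lt_succ_iff.1 (lt_of_lt_of_le (Finset.card_lt_card ?_) hn)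
      rw [Finset.ssubset_iff_of_subset]
      · rcases min_choice (q i - p i) (-(q (k + 1) - p (k + 1))) with hc | hc
        · refine ⟨i, Finset.mem_filter.2 ⟨hiT, by intro hc; linarith⟩, ?_⟩
          rw [← hδd] at hc
          simp [hij, hc]
        · refine ⟨k + 1, Finset.mem_filter.2 ⟨hjm, by intro hc; linarith⟩, ?_⟩
          rw [← hδd] at hc
          simp [hij.symm, hc]
      · intro t ht
        obtain ⟨h1, h2⟩ := Finset.mem_filter.1 ht
        refine Finset.mem_filter.2 ⟨h1, ?_⟩
        by_cases a : t = i
        · subst a; intro hc; linarith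
        by_cases b : t = k + 1
        · subst b; intro hc; linarith
        simpa [a, b] using h2
    · intro s hs
      rw [hsum]
      have h1 := hpre s hs
      by_cases a : i ≤ s <;> by_cases b : k + 1 ≤ s <;> simp only [a, b, if_true, if_false]
      · linarith
      · have : ∑ t ∈ Finset.Icc 1 s, (q t - p t) = ∑ t ∈ Finset.Icc 1 k, (q t - p t) := by
          refine Finset.sum_subset (Finset.Icc_subset_Icc_right (by omega)) fun t ht ht' => ?_
          simp only [Finset.mem_Icc] at ht ht'
          exact hzero t (by omega) (by omega)
        linarith
      · omega
      · linarith
    · rw [hsum, htot, if_pos (by omega), if_pos hjT]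
      ring

/-- Theorem 1, sufficiency: if the nonincreasing nonnegative supply profile `p`
is majorized by the demand profile `d` of loads `(ℓ, h)` — i.e.
`∑_{t=1}^s p_t ≤ ∑_{t=1}^s d_t` for `s = 1,…,T−1` and total energies are
equal — then `p` is exactly adequate for the loads `(ℓ, h)`. -/
theorem adequacy_sufficiency (T : ℕ) (hT : 1 ≤ T)
    (ℓ : ℝ → ℝ) (h : ℝ → ℕ)
    (hℓmeas : Measurable ℓ) (hℓnonneg : ∀ x, 0 ≤ ℓ x)
    (hℓint : IntegrableOn ℓ (Set.Icc (0 : ℝ) 1))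
    (hhmeas : Measurable h) (hhrange : ∀ x, h x ∈ Finset.Icc 1 T)
    (p : ℕ → ℝ)
    (hpmono : ∀ s t : ℕ, 1 ≤ s → s ≤ t → t ≤ T → p t ≤ p s)
    (hpnonneg : ∀ t ∈ Finset.Icc 1 T, 0 ≤ p t)
    (hmaj_le : ∀ s ∈ Finset.Icc 1 (T - 1),
      ∑ t ∈ Finset.Icc 1 s, p t ≤ ∑ t ∈ Finset.Icc 1 s, demandProfile ℓ h t)
    (hmaj_eq : ∑ t ∈ Finset.Icc 1 T, p t
      = ∑ t ∈ Finset.Icc 1 T, demandProfile ℓ h t) :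
    ExactlyAdequate T ℓ h p := by
  have hd : ExactlyAdequate T ℓ h (demandProfile ℓ h) := by
    refine ⟨fun x t => if t ≤ h x then 1 else 0, ?_, ?_, fun t _ => rfl, ?_⟩
    · intro t
      exact Measurable.ite (hhmeas (measurableSet_Ici (a := t))) measurable_const measurable_const
    · intro x t
      by_cases a : t ≤ h x <;> simp [a]
    · refine Filter.Eventually.of_forall fun x => ?_
      obtain ⟨h1, h2⟩ := Finset.mem_Icc.1 (hhrange x)
      have : (Finset.Icc 1 T).filter (fun t => t ≤ h x) = Finset.Icc 1 (h x) := by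
        ext t
        simp only [Finset.mem_filter, Finset.mem_Icc]
        omega
      rw [← Finset.sum_filter, this]
      simp
  refine majorization_induction T p (ExactlyAdequate T ℓ h) hpmono
    (fun q hq hpq => adequate_congr hq hpq)
    (fun q hq i hi j hj hij δ h0 hδ => adequate_transfer hℓnonneg hℓint hq hi hj hij h0 hδ)
    _ (demandProfile ℓ h) le_rfl hd ?_ ?_
  · intro s hs
    rw [Finset.sum_sub_distrib, sub_nonneg]
    rcases Nat.eq_zero_or_pos s with rfl | hpos
    · simp
    rcases hs.eq_or_lt with rfl | hlt
    · exact hmaj_eq.le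
    · exact hmaj_le s (Finset.mem_Icc.2 ⟨hpos, by omega⟩)
  · rw [Finset.sum_sub_distrib, hmaj_eq, sub_self]
end

section
/- Let T ≥ 1 and let p = (p_1,…,p_T) be a supply profile with p_1 ≥ p_2 ≥ … ≥ p_T ≥ 0, and let (ℓ, h) be loads with demand profile d = (d_1,…,d_T). If p is exactly adequate for the loads (ℓ, h), then p is majorized by d: ∑_{t=1}^{s} p_t ≤ ∑_{t=1}^{s} d_t for s = 1,…,T−1 and ∑_{t=1}^{T} p_t = ∑_{t=1}^{T} d_t. (Necessity direction of Theorem 1.) -/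
open MeasureTheory

theorem sum_ind_aux (s n : ℕ) :
    ∑ t ∈ Finset.Icc 1 s, (if t ≤ n then (1 : ℝ) else 0) = ((min s n : ℕ) : ℝ) := by
  rw [Finset.sum_boole]
  have : Finset.filter (fun t => t ≤ n) (Finset.Icc 1 s) = Finset.Icc 1 (min s n) := by
    ext t
    simp only [Finset.mem_filter, Finset.mem_Icc]
    omega
  rw [this]
  simp

/-- Theorem 1, necessity: if the nonincreasing nonnegative supply profile `p`
is exactly adequate for loads `(ℓ, h)` with demand profile `d`, then `p` is
majorized by `d`: `∑_{t=1}^s p_t ≤ ∑_{t=1}^s d_t` for `s = 1,…,T−1` and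
`∑_{t=1}^T p_t = ∑_{t=1}^T d_t`. -/
theorem adequacy_necessity (T : ℕ) (hT : 1 ≤ T)
    (ℓ : ℝ → ℝ) (h : ℝ → ℕ)
    (hℓmeas : Measurable ℓ) (hℓnonneg : ∀ x, 0 ≤ ℓ x)
    (hℓint : IntegrableOn ℓ (Set.Icc (0 : ℝ) 1))
    (hhmeas : Measurable h) (hhrange : ∀ x, h x ∈ Finset.Icc 1 T)
    (p : ℕ → ℝ)
    (hpmono : ∀ s t : ℕ, 1 ≤ s → s ≤ t → t ≤ T → p t ≤ p s)
    (hpnonneg : ∀ t ∈ Finset.Icc 1 T, 0 ≤ p t)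
    (hadeq : ExactlyAdequate T ℓ h p) :
    (∀ s ∈ Finset.Icc 1 (T - 1),
      ∑ t ∈ Finset.Icc 1 s, p t ≤ ∑ t ∈ Finset.Icc 1 s, demandProfile ℓ h t) ∧
    ∑ t ∈ Finset.Icc 1 T, p t = ∑ t ∈ Finset.Icc 1 T, demandProfile ℓ h t := by
  obtain ⟨A, hAm, hA01, hAp, hAs⟩ := hadeq
  have hbdd : ∀ g : ℝ → ℝ, Measurable g → (∀ x, g x = 0 ∨ g x = 1) →
      IntegrableOn (fun x => ℓ x * g x) (Set.Icc (0 : ℝ) 1) := by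
    intro g hg h01
    refine Integrable.mono hℓint (hℓmeas.mul hg).aestronglyMeasurable ?_
    refine Filter.Eventually.of_forall fun x => ?_
    rcases h01 x with h0 | h0 <;> simp [h0]
  have hIA : ∀ t, IntegrableOn (fun x => ℓ x * A x t) (Set.Icc (0 : ℝ) 1) :=
    fun t => hbdd _ (hAm t) (fun x => hA01 x t)
  have hID : ∀ t : ℕ, IntegrableOn (fun x => ℓ x * (if t ≤ h x then (1 : ℝ) else 0))
      (Set.Icc (0 : ℝ) 1) := by
    intro t
    refine hbdd _ ?_ (fun x => ?_)
    · exact Measurable.ite (measurableSet_le measurable_const hhmeas)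
        measurable_const measurable_const
    · by_cases hx : t ≤ h x <;> simp [hx]
  have hP : ∀ s ≤ T, ∑ t ∈ Finset.Icc 1 s, p t =
      ∫ x in Set.Icc (0 : ℝ) 1, ∑ t ∈ Finset.Icc 1 s, ℓ x * A x t := by
    intro s hs
    rw [integral_finset_sum _ (fun t _ => hIA t)]
    refine Finset.sum_congr rfl fun t ht => ?_
    rw [Finset.mem_Icc] at ht
    exact (hAp t (Finset.mem_Icc.2 ⟨ht.1, ht.2.trans hs⟩)).symm
  have hD : ∀ s : ℕ, ∑ t ∈ Finset.Icc 1 s, demandProfile ℓ h t =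
      ∫ x in Set.Icc (0 : ℝ) 1,
        ∑ t ∈ Finset.Icc 1 s, ℓ x * (if t ≤ h x then (1 : ℝ) else 0) := by
    intro s
    rw [integral_finset_sum _ (fun t _ => hID t)]
    rfl
  constructor
  · intro s hs
    rw [Finset.mem_Icc] at hs
    have hsT : s ≤ T := by omega
    rw [hP s hsT, hD s]
    refine integral_mono_ae (integrable_finset_sum _ fun t _ => hIA t)
      (integrable_finset_sum _ fun t _ => hID t) ?_
    filter_upwards [hAs] with x hx
    rw [← Finset.mul_sum, ← Finset.mul_sum, sum_ind_aux]
    refine mul_le_mul_of_nonneg_left ?_ (hℓnonneg x)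
    rw [Nat.cast_min]
    refine le_min ?_ ?_
    · calc ∑ t ∈ Finset.Icc 1 s, A x t ≤ ∑ t ∈ Finset.Icc 1 s, (1 : ℝ) :=
            Finset.sum_le_sum fun t _ => by rcases hA01 x t with h0 | h0 <;> simp [h0]
        _ = s := by simp
    · rw [← hx]
      refine Finset.sum_le_sum_of_subset_of_nonneg (Finset.Icc_subset_Icc_right hsT) ?_
      intro t _ _
      rcases hA01 x t with h0 | h0 <;> simp [h0]
  · rw [hP T le_rfl, hD T]
    refine integral_congr_ae ?_
    filter_upwards [hAs] with x hx
    rw [← Finset.mul_sum, ← Finset.mul_sum, sum_ind_aux, hx,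
      min_eq_right (Finset.mem_Icc.1 (hhrange x)).2]
end

section
/- Exact adequacy is preserved under a Robin Hood transfer: suppose the profile a = (a_1,…,a_T) (with a_1 ≥ … ≥ a_T ≥ 0) is exactly adequate for loads (ℓ, h), and let ã be obtained from a by selecting indices t, s with a_t > a_s, replacing a_t by a_t − ε and a_s by a_s + ε for some ε ∈ (0, a_t − a_s), and rearranging the resulting vector in nonincreasing order. Then ã is exactly adequate for the loads (ℓ, h). -/
open MeasureTheory

/-- Exact adequacy is preserved under a Robin Hood transfer: if the
nonincreasing nonnegative profile `a` is exactly adequate for loads `(ℓ, h)`,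
and `ã` is obtained from `a` by moving an amount `ε ∈ (0, a_t − a_s)` from an
index `t` with `a_t > a_s` to the index `s` and rearranging the result in
nonincreasing order (via a permutation `σ` of `{1,…,T}`), then `ã` is exactly
adequate for `(ℓ, h)`. -/
theorem robin_hood_preserves_adequacy (T : ℕ) (hT : 1 ≤ T)
    (ℓ : ℝ → ℝ) (h : ℝ → ℕ)
    (hℓmeas : Measurable ℓ) (hℓnonneg : ∀ x, 0 ≤ ℓ x)
    (hℓint : IntegrableOn ℓ (Set.Icc (0 : ℝ) 1))
    (hhmeas : Measurable h) (hhrange : ∀ x, h x ∈ Finset.Icc 1 T)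
    (a : ℕ → ℝ)
    (hamono : ∀ i j : ℕ, 1 ≤ i → i ≤ j → j ≤ T → a j ≤ a i)
    (hanonneg : ∀ i ∈ Finset.Icc 1 T, 0 ≤ a i)
    (hadeq : ExactlyAdequate T ℓ h a)
    (t s : ℕ) (ht : t ∈ Finset.Icc 1 T) (hs : s ∈ Finset.Icc 1 T)
    (hts : a s < a t)
    (ε : ℝ) (hε₀ : 0 < ε) (hε₁ : ε < a t - a s)
    (atil : ℕ → ℝ)
    (hperm : ∃ σ : Equiv.Perm ℕ,
      (∀ i ∈ Finset.Icc 1 T, σ i ∈ Finset.Icc 1 T) ∧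
      (∀ i ∈ Finset.Icc 1 T,
        atil i = a (σ i) - (if σ i = t then ε else 0) + (if σ i = s then ε else 0)))
    (hatilmono : ∀ i j : ℕ, 1 ≤ i → i ≤ j → j ≤ T → atil j ≤ atil i) :
    ExactlyAdequate T ℓ h atil := by
  obtain ⟨A, hAm, hA01, hAint, hAsum⟩ := hadeq
  obtain ⟨σ, hσ, hatil⟩ := hperm
  have hne : t ≠ s := by
    rintro rfl
    exact lt_irrefl _ hts
  have hint : ∀ j, IntegrableOn (fun x => ℓ x * A x j) (Set.Icc (0 : ℝ) 1) := by
    intro j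
    refine Integrable.mono' hℓint (hℓmeas.mul (hAm j)).aestronglyMeasurable ?_
    refine Filter.Eventually.of_forall fun x => ?_
    have h0 := hℓnonneg x
    rcases hA01 x j with h1 | h1 <;> simp [h1, h0, abs_of_nonneg]
  set g : ℝ → ℝ := fun x => ℓ x * A x t - ℓ x * A x s with hg
  have hgint : IntegrableOn g (Set.Icc (0 : ℝ) 1) := (hint t).sub (hint s)
  have hcont : ContinuousOn (fun y => ∫ x in (0 : ℝ)..y, g x) (Set.Icc 0 1) := by
    have := intervalIntegral.continuousOn_primitive_interval (μ := volume) (f := g)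
      (a := 0) (b := 1) (by rwa [Set.uIcc_of_le zero_le_one])
    rwa [Set.uIcc_of_le zero_le_one] at this
  have hg1 : ∫ x in (0 : ℝ)..1, g x = a t - a s := by
    rw [intervalIntegral.integral_of_le zero_le_one, ← integral_Icc_eq_integral_Ioc,
      ← hAint t ht, ← hAint s hs]
    exact integral_sub (hint t) (hint s)
  obtain ⟨y, hy, hyε⟩ := intermediate_value_Icc (zero_le_one' ℝ) hcont
    (show ε ∈ Set.Icc _ _ by
      simp only [intervalIntegral.integral_same, hg1]
      exact ⟨hε₀.le, hε₁.le⟩)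
  have hgy : ∫ x in Set.Icc (0 : ℝ) 1, (Set.Iic y).indicator g x = ε := by
    rw [setIntegral_indicator measurableSet_Iic]
    have : Set.Icc (0 : ℝ) 1 ∩ Set.Iic y = Set.Icc 0 y := by
      ext x
      simp only [Set.mem_inter_iff, Set.mem_Icc, Set.mem_Iic]
      exact ⟨fun h => ⟨h.1.1, h.2⟩, fun h => ⟨⟨h.1, h.2.trans hy.2⟩, h.2⟩⟩
    rw [this, integral_Icc_eq_integral_Ioc, ← intervalIntegral.integral_of_le hy.1]
    exact hyε
  have hgiint : IntegrableOn ((Set.Iic y).indicator g) (Set.Icc (0 : ℝ) 1) :=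
    hgint.indicator measurableSet_Iic
  -- swapping over a permutation of the slots does not change the sum
  have hsumperm : ∀ (π : Equiv.Perm ℕ), (∀ i ∈ Finset.Icc 1 T, π i ∈ Finset.Icc 1 T) →
      ∀ f : ℕ → ℝ, ∑ i ∈ Finset.Icc 1 T, f (π i) = ∑ i ∈ Finset.Icc 1 T, f i := by
    intro π hπ f
    have himg : (Finset.Icc 1 T).image π = Finset.Icc 1 T := by
      apply Finset.eq_of_subset_of_card_le
      · intro j hj
        obtain ⟨i, hi, rfl⟩ := Finset.mem_image.1 hj
        exact hπ i hi
      · rw [Finset.card_image_of_injective _ π.injective]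
    conv_rhs => rw [← himg]
    rw [Finset.sum_image (fun _ _ _ _ h => π.injective h)]
  have hswap : ∀ i ∈ Finset.Icc 1 T, Equiv.swap t s i ∈ Finset.Icc 1 T := by
    intro i hi
    rw [Equiv.swap_apply_def]
    split_ifs <;> assumption
  refine ⟨fun x i => if x ≤ y then A x (Equiv.swap t s (σ i)) else A x (σ i), ?_, ?_, ?_, ?_⟩
  · intro i
    exact Measurable.ite measurableSet_Iic (hAm _) (hAm _)
  · intro x i
    dsimp only
    split_ifs <;> exact hA01 _ _
  · intro i hi
    rw [hatil i hi]
    by_cases h1 : σ i = t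
    · have : (fun x => ℓ x * (if x ≤ y then A x (Equiv.swap t s (σ i)) else A x (σ i))) =
          fun x => ℓ x * A x t - (Set.Iic y).indicator g x := by
        ext x
        by_cases hx : x ≤ y <;> simp [hx, h1, hg, Set.indicator]
      rw [this, integral_sub (hint t) hgiint, hgy, hAint t ht]
      simp [h1, hne]
    · by_cases h2 : σ i = s
      · have : (fun x => ℓ x * (if x ≤ y then A x (Equiv.swap t s (σ i)) else A x (σ i))) =
            fun x => ℓ x * A x s + (Set.Iic y).indicator g x := by
          ext x
          by_cases hx : x ≤ y <;> simp [hx, h2, hg, Set.indicator]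
        rw [this, integral_add (hint s) hgiint, hgy, hAint s hs]
        simp [h2, hne.symm]
      · beta_reduce
        rw [Equiv.swap_apply_of_ne_of_ne h1 h2]
        simp only [ite_self, h1, h2, if_false, sub_zero, add_zero]
        exact hAint _ (hσ i hi)
  · filter_upwards [hAsum] with x hx
    rw [← hx]
    by_cases hxy : x ≤ y
    · simp only [hxy, if_true]
      rw [hsumperm σ hσ (fun j => A x (Equiv.swap t s j)), hsumperm _ hswap (fun j => A x j)]
    · simp only [hxy, if_false]
      exact hsumperm σ hσ (fun j => A x j)
end

section
/- Characterization of simple adequacy (Theorem 2): let p = (p_1,…,p_T) be a supply profile with p_1 ≥ … ≥ p_T ≥ 0 and let (ℓ, h) be loads with demand profile d = (d_1,…,d_T). Then p is simply adequate for the loads (ℓ, h) if and only if ∑_{t=s}^{T} d_t ≤ ∑_{t=s}^{T} p_t for every s = 1,…,T. -/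
open MeasureTheory

/-- A supply profile `p` is simply adequate for loads `(ℓ, h)` if there is a
measurable `{0,1}`-valued allocation `A` with `∫_0^1 ℓ(x) A(x,t) dx ≤ p_t` for
every slot `t ∈ {1,…,T}` and `∑_{t=1}^T A(x,t) = h(x)` for a.e. `x ∈ [0,1]`. -/
def SimplyAdequate (T : ℕ) (ℓ : ℝ → ℝ) (h : ℝ → ℕ) (p : ℕ → ℝ) : Prop :=
  ∃ A : ℝ → ℕ → ℝ,
    (∀ t : ℕ, Measurable fun x => A x t) ∧
    (∀ x : ℝ, ∀ t : ℕ, A x t = 0 ∨ A x t = 1) ∧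
    (∀ t ∈ Finset.Icc 1 T, (∫ x in Set.Icc (0 : ℝ) 1, ℓ x * A x t) ≤ p t) ∧
    (∀ᵐ x ∂(volume.restrict (Set.Icc (0 : ℝ) 1)),
      ∑ t ∈ Finset.Icc 1 T, A x t = (h x : ℝ))

lemma sumInd (a s n : ℕ) (ha : a ≤ n) :
    ∑ t ∈ Finset.Icc s n, (if t ≤ a then (1 : ℝ) else 0) = ((a + 1 - s : ℕ) : ℝ) := by
  rw [Finset.sum_ite, Finset.sum_const_zero, add_zero, Finset.sum_const, nsmul_eq_mul, mul_one]
  have : (Finset.Icc s n).filter (fun t => t ≤ a) = Finset.Icc s a := by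
    ext t; simp only [Finset.mem_filter, Finset.mem_Icc]; omega
  rw [this, Nat.card_Icc]

lemma intInd {ℓ : ℝ → ℝ} (hℓint : IntegrableOn ℓ (Set.Icc (0 : ℝ) 1)) (f : ℝ → ℝ)
    (hf : Measurable f) (hf' : ∀ x, f x = 0 ∨ f x = 1) :
    Integrable (fun x => ℓ x * f x) (volume.restrict (Set.Icc (0 : ℝ) 1)) := by
  refine Integrable.mul_bdd (c := 1) hℓint hf.aestronglyMeasurable (Filter.Eventually.of_forall ?_)
  intro x
  rcases hf' x with h | h <;> simp [h]

lemma measInd {h : ℝ → ℕ} (hh : Measurable h) (t : ℕ) :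
    Measurable (fun x => if t ≤ h x then (1 : ℝ) else 0) :=
  Measurable.ite (measurableSet_le measurable_const hh) measurable_const measurable_const

lemma intDem {ℓ : ℝ → ℝ} (hℓint : IntegrableOn ℓ (Set.Icc (0 : ℝ) 1)) {h : ℝ → ℕ}
    (hh : Measurable h) (t : ℕ) :
    Integrable (fun x => ℓ x * (if t ≤ h x then (1 : ℝ) else 0))
      (volume.restrict (Set.Icc (0 : ℝ) 1)) := by
  refine intInd hℓint _ (measInd hh t) ?_
  intro x; by_cases hx : t ≤ h x <;> simp [hx]

lemma tailDem {ℓ : ℝ → ℝ} (hℓint : IntegrableOn ℓ (Set.Icc (0 : ℝ) 1)) {h : ℝ → ℕ}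
    (hh : Measurable h) (s n : ℕ) (hn : ∀ x, h x ≤ n) :
    ∑ t ∈ Finset.Icc s n, demandProfile ℓ h t =
      ∫ x in Set.Icc (0 : ℝ) 1, ℓ x * ((h x + 1 - s : ℕ) : ℝ) := by
  unfold demandProfile
  rw [← integral_finsetSum _ (fun t _ => intDem hℓint hh t)]
  congr 1; ext x
  rw [← Finset.mul_sum, sumInd _ _ _ (hn x)]

lemma intTail {ℓ : ℝ → ℝ} (hℓint : IntegrableOn ℓ (Set.Icc (0 : ℝ) 1)) {h : ℝ → ℕ}
    (hh : Measurable h) (s n : ℕ) (hn : ∀ x, h x ≤ n) :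
    Integrable (fun x => ℓ x * ((h x + 1 - s : ℕ) : ℝ))
      (volume.restrict (Set.Icc (0 : ℝ) 1)) := by
  have := integrable_finsetSum (Finset.Icc s n) (fun t _ => intDem hℓint hh t)
  refine this.congr (Filter.Eventually.of_forall fun x => ?_)
  simp only
  rw [← Finset.mul_sum, sumInd _ _ _ (hn x)]

lemma demAnti {ℓ : ℝ → ℝ} (hℓnonneg : ∀ x, 0 ≤ ℓ x)
    (hℓint : IntegrableOn ℓ (Set.Icc (0 : ℝ) 1)) {h : ℝ → ℕ}
    (hh : Measurable h) {s t : ℕ} (hst : s ≤ t) :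
    demandProfile ℓ h t ≤ demandProfile ℓ h s := by
  refine integral_mono (intDem hℓint hh t) (intDem hℓint hh s) fun x => ?_
  refine mul_le_mul_of_nonneg_left ?_ (hℓnonneg x)
  split_ifs <;> first | omega | norm_num

/-- Cutting set: includes everything above level `k`, nothing below level `k`. -/
lemma cutSet {ℓ : ℝ → ℝ} 
    (hℓint : IntegrableOn ℓ (Set.Icc (0 : ℝ) 1)) {h : ℝ → ℕ}
    (hh : Measurable h) (k : ℕ) (q : ℝ) (h1 : demandProfile ℓ h (k + 1) ≤ q)
    (h2 : q ≤ demandProfile ℓ h k) :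
    ∃ f : ℝ → ℕ, Measurable f ∧ (∀ x, f x ≤ 1) ∧ (∀ x, k + 1 ≤ h x → f x = 1) ∧
      (∀ x, h x < k → f x = 0) ∧ ∫ x in Set.Icc (0 : ℝ) 1, ℓ x * (f x : ℝ) = q := by
  set g : ℝ → ℝ := fun x => ℓ x * (if k ≤ h x then (1 : ℝ) else 0) -
    ℓ x * (if k + 1 ≤ h x then (1 : ℝ) else 0) with hg
  have hgi : IntegrableOn g (Set.Icc (0 : ℝ) 1) := (intDem hℓint hh k).sub (intDem hℓint hh (k+1))
  have hcont : ContinuousOn (fun c => ∫ x in Set.Ioc (0:ℝ) c, g x) (Set.Icc 0 1) :=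
    intervalIntegral.continuousOn_primitive hgi
  have hgtot : ∫ x in Set.Icc (0:ℝ) 1, g x =
      demandProfile ℓ h k - demandProfile ℓ h (k+1) :=
    integral_sub (intDem hℓint hh k) (intDem hℓint hh (k+1))
  have hmem : q - demandProfile ℓ h (k+1) ∈
      Set.Icc (∫ x in Set.Ioc (0:ℝ) 0, g x) (∫ x in Set.Ioc (0:ℝ) 1, g x) := by
    rw [← integral_Icc_eq_integral_Ioc (x := (0:ℝ)) (y := 1), hgtot]
    simp only [Set.Ioc_self, Measure.restrict_empty, integral_zero_measure]
    constructor <;> linarith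
  obtain ⟨c, hc, hcq⟩ := intermediate_value_Icc zero_le_one hcont hmem
  simp only at hcq
  refine ⟨fun x => if k + 1 ≤ h x then 1 else if k ≤ h x ∧ x ≤ c then 1 else 0, ?_, ?_, ?_, ?_, ?_⟩
  · refine Measurable.ite (measurableSet_le measurable_const hh) measurable_const
      (Measurable.ite ?_ measurable_const measurable_const)
    exact (measurableSet_le measurable_const hh).inter measurableSet_Iic
  · intro x; simp only; split_ifs <;> simp
  · intro x hx; simp [hx]
  · intro x hx
    have : ¬ (k + 1 ≤ h x) := by omega
    have h' : ¬ (k ≤ h x) := by omega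
    simp [this, h']
  · have e : ∀ x, ℓ x * (((if k + 1 ≤ h x then 1 else if k ≤ h x ∧ x ≤ c then 1 else 0 : ℕ)) : ℝ)
        = ℓ x * (if k + 1 ≤ h x then (1 : ℝ) else 0) + (Set.Iic c).indicator g x := by
      intro x
      simp only [hg, Set.indicator, Set.mem_Iic]
      by_cases a1 : k + 1 ≤ h x
      · have : k ≤ h x := by omega
        simp [a1, this]
      · by_cases a2 : k ≤ h x <;> by_cases a3 : x ≤ c <;> simp [a1, a2, a3]
    simp only [e]
    rw [integral_add (intDem hℓint hh (k+1)) (hgi.integrable.indicator measurableSet_Iic),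
      integral_indicator measurableSet_Iic, Measure.restrict_restrict measurableSet_Iic]
    have : Set.Iic c ∩ Set.Icc 0 1 = Set.Icc 0 c := by
      ext x; simp only [Set.mem_inter_iff, Set.mem_Iic, Set.mem_Icc]
      constructor
      · rintro ⟨a, b, _⟩; exact ⟨b, a⟩
      · rintro ⟨a, b⟩; exact ⟨b, a, b.trans hc.2⟩
    rw [this, integral_Icc_eq_integral_Ioc (x := (0:ℝ)) (y := c), hcq]
    unfold demandProfile; ring

lemma suffAux {ℓ : ℝ → ℝ} (hℓnonneg : ∀ x, 0 ≤ ℓ x)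
    (hℓint : IntegrableOn ℓ (Set.Icc (0 : ℝ) 1)) (p : ℕ → ℝ) (T : ℕ) :
    ∀ h : ℝ → ℕ, Measurable h → (∀ x, h x ≤ T) →
    (∀ s t : ℕ, 1 ≤ s → s ≤ t → t ≤ T → p t ≤ p s) →
    (∀ s ∈ Finset.Icc 1 T,
        ∑ t ∈ Finset.Icc s T, demandProfile ℓ h t ≤ ∑ t ∈ Finset.Icc s T, p t) →
    SimplyAdequate T ℓ h p := by
  induction T with
  | zero =>
    intro h hh hT _ _
    refine ⟨fun _ _ => 0, fun _ => measurable_const, fun _ _ => Or.inl rfl, ?_, ?_⟩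
    · intro t ht; simp at ht
    · refine Filter.Eventually.of_forall fun x => ?_
      have h0 : h x = 0 := Nat.le_zero.1 (hT x)
      simp [h0]
  | succ n ih =>
    intro h hh hT hp htail
    have hlast : demandProfile ℓ h (n+1) ≤ p (n+1) := by
      have := htail (n+1) (by simp)
      simpa using this
    -- the level `k` and the served set
    obtain ⟨k, hkn, hk1, f, hfm, hf1, hfup, hflow, hf0, hfle, hfeq⟩ :
        ∃ k, k ≤ n ∧ demandProfile ℓ h (k+1) ≤ p (n+1) ∧ ∃ f : ℝ → ℕ, Measurable f ∧ (∀ x, f x ≤ 1)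
        ∧ (∀ x, k + 1 ≤ h x → f x = 1) ∧ (∀ x, h x < k → f x = 0) ∧ (∀ x, h x = 0 → f x = 0) ∧
        (∫ x in Set.Icc (0 : ℝ) 1, ℓ x * (f x : ℝ) ≤ p (n+1)) ∧
        (1 ≤ k → ∫ x in Set.Icc (0 : ℝ) 1, ℓ x * (f x : ℝ) = p (n+1)) := by
      classical
      have hex : ∃ k, demandProfile ℓ h (k+1) ≤ p (n+1) := ⟨n, hlast⟩
      have hs := Nat.find_spec hex
      have hle : Nat.find hex ≤ n := Nat.find_min' hex hlast
      have hmin : ∀ m, m < Nat.find hex → ¬ demandProfile ℓ h (m+1) ≤ p (n+1) :=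
        fun m hm => Nat.find_min hex hm
      generalize Nat.find hex = k at hs hle hmin
      refine ⟨k, hle, hs, ?_⟩
      rcases Nat.eq_zero_or_pos k with rfl | hk
      · refine ⟨fun x => if 1 ≤ h x then 1 else 0, ?_, ?_, ?_, ?_, ?_, ?_, ?_⟩
        · exact Measurable.ite (measurableSet_le measurable_const hh) measurable_const
            measurable_const
        · intro x; simp only; split_ifs <;> simp
        · intro x hx; simp only [zero_add] at hx; simp [hx]
        · intro x hx; omega
        · intro x hx; simp [hx]
        · simpa [demandProfile] using hs
        · intro hx; omega
      · have h2 : p (n+1) ≤ demandProfile ℓ h k := by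
          have := hmin (k-1) (by omega)
          rw [Nat.sub_add_cancel hk] at this
          linarith
        obtain ⟨f, a, b, c, d, e⟩ := cutSet hℓint hh k _ hs h2
        exact ⟨f, a, b, c, d, fun x hx => d x (by omega), e.le, fun _ => e⟩
    set h' : ℝ → ℕ := fun x => h x - f x with hh'
    have hh'm : Measurable h' := hh.sub hfm
    have hh'n : ∀ x, h' x ≤ n := by
      intro x
      have := hT x
      have := hfup x
      simp only [hh']; omega
    have hfh : ∀ x, f x ≤ h x := by
      intro x
      have := hf1 x
      have := hf0 x
      omega
    have hfi : Integrable (fun x => ℓ x * (f x : ℝ)) (volume.restrict (Set.Icc (0 : ℝ) 1)) := by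
      refine intInd hℓint (fun x => (f x : ℝ)) (measurable_from_top.comp hfm) ?_
      intro x
      have := hf1 x
      rcases Nat.le_one_iff_eq_zero_or_eq_one.1 this with h | h <;> simp [h]
    have htail' : ∀ s ∈ Finset.Icc 1 n,
        ∑ t ∈ Finset.Icc s n, demandProfile ℓ h' t ≤ ∑ t ∈ Finset.Icc s n, p t := by
      intro s hs
      rw [Finset.mem_Icc] at hs
      by_cases hsk : s ≤ k
      · have h1 := htail s (by simp; omega)
        rw [Finset.sum_Icc_succ_top (by omega : s ≤ n+1) p, tailDem hℓint hh _ _ hT] at h1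
        rw [tailDem hℓint hh'm _ _ hh'n]
        have e : ∀ x, ℓ x * ((h' x + 1 - s : ℕ) : ℝ) =
            ℓ x * ((h x + 1 - s : ℕ) : ℝ) - ℓ x * (f x : ℝ) := by
          intro x
          rw [← mul_sub]
          congr 1
          rw [eq_sub_iff_add_eq]
          norm_cast
          have := hf1 x
          have := hflow x
          have := hfh x
          simp only [hh']; omega
        simp only [e]
        rw [integral_sub (intTail hℓint hh _ _ hT) hfi, hfeq (by omega)]
        linarith
      · refine Finset.sum_le_sum fun t ht => ?_
        rw [Finset.mem_Icc] at ht
        have e : demandProfile ℓ h' t = demandProfile ℓ h (t+1) := by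
          unfold demandProfile
          congr 1; ext x
          have : t ≤ h' x ↔ t + 1 ≤ h x := by
            have := hf1 x
            have := hfup x
            have := hfh x
            simp only [hh']; omega
          simp only [this]
        rw [e]
        exact (demAnti hℓnonneg hℓint hh (by omega : k + 1 ≤ t + 1)).trans
          (hk1.trans (hp t (n+1) (by omega) (by omega) le_rfl))
    obtain ⟨A, hA1, hA2, hA3, hA4⟩ := ih h' hh'm hh'n
      (fun s t a b c => hp s t a b (by omega)) htail'
    refine ⟨fun x t => if t = n+1 then (f x : ℝ) else A x t, ?_, ?_, ?_, ?_⟩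
    · intro t
      by_cases ht : t = n + 1
      · simp only [ht, if_true]; exact measurable_from_top.comp hfm
      · simp only [ht, if_false]; exact hA1 t
    · intro x t
      by_cases ht : t = n + 1
      · simp only [ht, if_true]
        rcases Nat.le_one_iff_eq_zero_or_eq_one.1 (hf1 x) with h | h <;> simp [h]
      · simp only [ht, if_false]; exact hA2 x t
    · intro t ht
      rw [Finset.mem_Icc] at ht
      by_cases htn : t = n + 1
      · simp only [htn, if_true]; exact hfle
      · simp only [htn, if_false]; exact hA3 t (by rw [Finset.mem_Icc]; omega)
    · filter_upwards [hA4] with x hx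
      rw [Finset.sum_Icc_succ_top (by omega : 1 ≤ n+1)]
      have : ∑ t ∈ Finset.Icc 1 n, (if t = n+1 then (f x : ℝ) else A x t)
          = ∑ t ∈ Finset.Icc 1 n, A x t := by
        refine Finset.sum_congr rfl fun t ht => ?_
        rw [Finset.mem_Icc] at ht
        rw [if_neg (by omega)]
      rw [this, hx]
      simp only [if_true, hh']
      rw [Nat.cast_sub (hfh x)]; ring

/-- Theorem 2: a nonincreasing nonnegative supply profile `p` is simply
adequate for loads `(ℓ, h)` with demand profile `d` if and only if
`∑_{t=s}^T d_t ≤ ∑_{t=s}^T p_t` for every `s = 1,…,T`. -/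
theorem simple_adequacy_characterization (T : ℕ) (hT : 1 ≤ T)
    (ℓ : ℝ → ℝ) (h : ℝ → ℕ)
    (hℓmeas : Measurable ℓ) (hℓnonneg : ∀ x, 0 ≤ ℓ x)
    (hℓint : IntegrableOn ℓ (Set.Icc (0 : ℝ) 1))
    (hhmeas : Measurable h) (hhrange : ∀ x, h x ∈ Finset.Icc 1 T)
    (p : ℕ → ℝ)
    (hpmono : ∀ s t : ℕ, 1 ≤ s → s ≤ t → t ≤ T → p t ≤ p s)
    (hpnonneg : ∀ t ∈ Finset.Icc 1 T, 0 ≤ p t) :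
    SimplyAdequate T ℓ h p ↔
      ∀ s ∈ Finset.Icc 1 T,
        ∑ t ∈ Finset.Icc s T, demandProfile ℓ h t ≤ ∑ t ∈ Finset.Icc s T, p t := by
  constructor
  · rintro ⟨A, hA1, hA2, hA3, hA4⟩ s hs
    have hT' : ∀ x, h x ≤ T := fun x => (Finset.mem_Icc.1 (hhrange x)).2
    rw [Finset.mem_Icc] at hs
    have hAi : ∀ t, Integrable (fun x => ℓ x * A x t) (volume.restrict (Set.Icc (0 : ℝ) 1)) :=
      fun t => intInd hℓint (fun x => A x t) (hA1 t) (fun x => hA2 x t)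
    calc ∑ t ∈ Finset.Icc s T, demandProfile ℓ h t
        = ∫ x in Set.Icc (0 : ℝ) 1, ℓ x * ((h x + 1 - s : ℕ) : ℝ) :=
          tailDem hℓint hhmeas _ _ hT'
      _ ≤ ∫ x in Set.Icc (0 : ℝ) 1, ∑ t ∈ Finset.Icc s T, ℓ x * A x t := by
          refine integral_mono_ae (intTail hℓint hhmeas _ _ hT')
            (integrable_finsetSum _ fun t _ => hAi t) ?_
          filter_upwards [hA4] with x hx
          rw [← Finset.mul_sum]
          refine mul_le_mul_of_nonneg_left ?_ (hℓnonneg x)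
          have hA0 : ∀ t, 0 ≤ A x t := fun t => by rcases hA2 x t with h | h <;> simp [h]
          have hAle : ∀ t, A x t ≤ 1 := fun t => by rcases hA2 x t with h | h <;> simp [h]
          have hsplit : ∑ t ∈ Finset.Icc 1 T, A x t ≤
              ∑ t ∈ Finset.Icc 1 (s-1), A x t + ∑ t ∈ Finset.Icc s T, A x t := by
            rw [← Finset.sum_union]
            · refine Finset.sum_le_sum_of_subset_of_nonneg ?_ fun t _ _ => hA0 t
              intro t ht
              simp only [Finset.mem_union, Finset.mem_Icc] at ht ⊢
              omega
            · rw [Finset.disjoint_left]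
              intro t ht
              simp only [Finset.mem_Icc] at ht ⊢
              omega
          have hfirst : ∑ t ∈ Finset.Icc 1 (s-1), A x t ≤ ((s - 1 : ℕ) : ℝ) := by
            refine (Finset.sum_le_sum fun t _ => hAle t).trans ?_
            simp
          by_cases hhs : s ≤ h x + 1
          · rw [Nat.cast_sub hhs]
            rw [Nat.cast_sub hs.1] at hfirst
            push_cast at hfirst ⊢
            linarith
          · rw [Nat.sub_eq_zero_of_le (by omega)]
            simpa using Finset.sum_nonneg fun t _ => hA0 t
      _ = ∑ t ∈ Finset.Icc s T, ∫ x in Set.Icc (0 : ℝ) 1, ℓ x * A x t :=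
          integral_finsetSum _ fun t _ => hAi t
      _ ≤ ∑ t ∈ Finset.Icc s T, p t := by
          refine Finset.sum_le_sum fun t ht => hA3 t ?_
          rw [Finset.mem_Icc] at ht ⊢
          omega
  · intro H
    exact suffAux hℓnonneg hℓint p T h hhmeas (fun x => (Finset.mem_Icc.1 (hhrange x)).2) hpmono H
end

section
/- Longest-Leftover-Duration-First allocation (Theorem 3, priority form): suppose the supply profile p = (p_1,…,p_T) (nonincreasing) is simply adequate for loads (ℓ, h), and let q = (q_1,…,q_T) be any permutation of p (the supply time profile). Then there exists a measurable allocation A : [0,1] × {1,…,T} → {0,1} such that (i) ∫_0^1 ℓ(x) A(x,t) dx ≤ q_t for every t, (ii) ∑_{t=1}^T A(x,t) = h(x) for almost every x, and (iii) for every slot t, defining the leftover duration y_t(x) = h(x) − ∑_{s=1}^{t−1} A(x,s), for almost every pair x, x′ ∈ [0,1]: if y_t(x) > y_t(x′) and A(x′,t) = 1, then A(x,t) = 1 (i.e., at each slot, loads with strictly longer leftover duration are served with priority). -/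
open MeasureTheory

lemma split_set (μ : Measure ℝ) [IsFiniteMeasure μ] [NullSingletonClass μ] (D : Set ℝ)
    (hD : MeasurableSet D) (r : ℝ) (h0 : 0 ≤ r) (h1 : r ≤ μ.real D) :
    ∃ D' ⊆ D, MeasurableSet D' ∧ μ.real D' = r := by
  rcases h0.eq_or_lt with h0 | h0
  · exact ⟨∅, by simp, by simp, by simp [h0]⟩
  rcases h1.eq_or_lt with h1 | h1
  · exact ⟨D, subset_rfl, hD, h1.symm⟩
  set m := μ.restrict D with hm
  have hg : Continuous fun b : ℝ => m.real (Set.Iic b) := by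
    rw [continuous_iff_continuousAt]
    intro b
    have := IntegrableOn.continuousOn_Iic_primitive_Iic (μ := m) (f := fun _ => (1:ℝ)) (a₀ := b+1)
      (integrable_const _).integrableOn
    have h2 := this.continuousAt (x := b) (Iic_mem_nhds (by linarith))
    simpa using h2
  have ht : Filter.Tendsto (fun b : ℝ => m.real (Set.Iic b)) Filter.atTop (nhds (m.real Set.univ)) :=
    (ENNReal.tendsto_toReal (measure_ne_top _ _)).comp (tendsto_measure_Iic_atTop m)
  have hb : Filter.Tendsto (fun b : ℝ => m.real (Set.Iic b)) Filter.atBot (nhds 0) := by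
    have := tendsto_measure_iInter_atBot (μ := m) (s := fun b : ℝ => Set.Iic b)
      (fun i => measurableSet_Iic.nullMeasurableSet) monotone_Iic ⟨0, measure_ne_top _ _⟩
    have h3 : (⋂ n : ℝ, Set.Iic n) = ∅ := by
      ext x; simp; exact ⟨x - 1, by linarith⟩
    rw [h3, measure_empty] at this
    have h4 := (ENNReal.tendsto_toReal (by simp)).comp this
    simpa only [ENNReal.toReal_zero] using! h4
  have hu : m.real Set.univ = μ.real D := by simp [hm]
  obtain ⟨b, hb⟩ := mem_range_of_exists_le_of_exists_ge (c := r) hg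
    ((hb.eventually_lt_const h0).exists.imp fun _ h => h.le)
    ((ht.eventually_const_lt (hu ▸ h1)).exists.imp fun _ h => h.le)
  refine ⟨Set.Iic b ∩ D, Set.inter_subset_right, measurableSet_Iic.inter hD, ?_⟩
  rw [← hb]
  simp [hm, measureReal_restrict_apply measurableSet_Iic]

open Classical in
noncomputable def cnt (S : Finset ℕ) (A : ℕ → Set ℝ) (x : ℝ) : ℕ := (S.filter fun t => x ∈ A t).card

def typ (S : Finset ℕ) (A : ℕ → Set ℝ) (α : Finset ℕ) : Set ℝ := {x | ∀ t ∈ S, x ∈ A t ↔ t ∈ α}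

lemma typ_meas (S : Finset ℕ) (A : ℕ → Set ℝ) (hA : ∀ t, MeasurableSet (A t)) (α : Finset ℕ) :
    MeasurableSet (typ S A α) := by
  have : typ S A α = ⋂ t ∈ S, {x | x ∈ A t ↔ t ∈ α} := by ext; simp [typ]
  rw [this]
  refine Finset.measurableSet_biInter _ fun t _ => ?_
  by_cases h : t ∈ α
  · simpa [h] using hA t
  · simp only [h, iff_false]; exact (hA t).compl

lemma cnt_eq_sum (S : Finset ℕ) (A : ℕ → Set ℝ) (x : ℝ) :
    cnt S A x = ∑ t ∈ S, (A t).indicator (fun _ => (1:ℕ)) x := by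
  classical
  rw [cnt, Finset.card_filter]
  exact Finset.sum_congr rfl fun t _ => by simp [Set.indicator_apply]

lemma cnt_meas (S : Finset ℕ) (A : ℕ → Set ℝ) (hA : ∀ t, MeasurableSet (A t)) :
    Measurable (cnt S A) := by
  have : cnt S A = fun x => ∑ t ∈ S, (A t).indicator (fun _ => (1:ℕ)) x := funext (cnt_eq_sum S A)
  rw [this]
  exact Finset.measurable_sum _ fun t _ => measurable_const.indicator (hA t)

lemma cnt_perm (S : Finset ℕ) (A A' : ℕ → Set ℝ) (x : ℝ) (σ : Equiv.Perm ℕ)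
    (hσ : ∀ s, s ∈ S ↔ σ s ∈ S) (h : ∀ s, x ∈ A' s ↔ x ∈ A (σ s)) : cnt S A' x = cnt S A x := by
  classical
  unfold cnt
  refine Finset.card_bij (fun s _ => σ s) ?_ ?_ ?_
  · intro s hs
    simp only [Finset.mem_filter] at hs ⊢
    exact ⟨(hσ s).1 hs.1, (h s).1 hs.2⟩
  · intro a _ b _ hab
    exact σ.injective hab
  · intro b hb
    simp only [Finset.mem_filter] at hb
    refine ⟨σ.symm b, ?_, by simp⟩
    simp only [Finset.mem_filter]
    exact ⟨(hσ _).2 (by simpa using hb.1), (h _).2 (by simpa using hb.2)⟩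

lemma swap_step (μ : Measure ℝ) [IsFiniteMeasure μ]
    (S : Finset ℕ) (A : ℕ → Set ℝ) (hA : ∀ t, MeasurableSet (A t)) (t0 t : ℕ)
    (ht0 : t0 ∈ S) (ht : t ∈ S) (D E : Set ℝ) (hD : MeasurableSet D) (hE : MeasurableSet E)
    (hDt0 : D ∩ A t0 = ∅) (hDt : D ⊆ A t) (hEt0 : E ⊆ A t0) (hEt : E ∩ A t = ∅)
    (hm : μ.real D = μ.real E) :
    ∃ A' : ℕ → Set ℝ, (∀ s, MeasurableSet (A' s)) ∧ (∀ s, μ.real (A' s) = μ.real (A s)) ∧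
      (∀ x, cnt S A' x = cnt S A x) ∧ A' t0 = (A t0 \ E) ∪ D ∧
      (∀ x, x ∉ D → x ∉ E → ∀ s, x ∈ A' s ↔ x ∈ A s) := by
  classical
  by_cases htt : t = t0
  · subst htt
    have h1 : D = ∅ := by rw [← hDt0]; exact (Set.inter_eq_left.2 hDt).symm
    have h2 : E = ∅ := by rw [← hEt]; exact (Set.inter_eq_left.2 hEt0).symm
    exact ⟨A, hA, fun _ => rfl, fun _ => rfl, by simp [h1, h2], fun _ _ _ _ => Iff.rfl⟩
  have key : ∀ P Q R : Set ℝ, MeasurableSet P → MeasurableSet Q → MeasurableSet R →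
      Q ∩ P = ∅ → R ⊆ P → μ.real Q = μ.real R → μ.real ((P \ R) ∪ Q) = μ.real P := by
    intro P Q R hP hQ hR hQP hRP hQR
    rw [measureReal_union _ hQ, hQR, add_comm, ← measureReal_inter_add_sdiff (s := P) hR,
      Set.inter_eq_right.2 hRP]
    rw [Set.disjoint_left]
    intro x hx hxQ
    have : x ∈ Q ∩ P := ⟨hxQ, hx.1⟩
    simp [hQP] at this
  refine ⟨fun s => if s = t0 then (A t0 \ E) ∪ D else if s = t then (A t \ D) ∪ E else A s,
    ?_, ?_, ?_, by simp, ?_⟩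
  · intro s
    dsimp only
    split_ifs
    · exact ((hA _).diff hE).union hD
    · exact ((hA _).diff hD).union hE
    · exact hA s
  · intro s
    dsimp only
    split_ifs with h1 h2
    · subst h1; exact key _ _ _ (hA _) hD hE hDt0 hEt0 hm
    · subst h2; exact key _ _ _ (hA _) hE hD hEt hDt hm.symm
    · rfl
  · intro x
    by_cases hx : x ∈ D ∪ E
    · refine cnt_perm S A _ x (Equiv.swap t0 t) ?_ ?_
      · intro s
        rw [Equiv.swap_apply_def]; split_ifs <;> simp_all
      · intro s
        have e1 : x ∈ D → x ∉ A t0 := fun h h' => by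
          have : x ∈ D ∩ A t0 := ⟨h, h'⟩
          simp [hDt0] at this
        have e2 : x ∈ E → x ∉ A t := fun h h' => by
          have : x ∈ E ∩ A t := ⟨h, h'⟩
          simp [hEt] at this
        have e3 := @hDt x
        have e4 := @hEt0 x
        rw [Equiv.swap_apply_def]
        split_ifs <;> simp only [Set.mem_union, Set.mem_sdiff] at * <;> tauto
    · refine cnt_perm S A _ x 1 (by simp) ?_
      intro s
      simp only [Set.mem_union, not_or] at hx
      split_ifs <;> simp_all
  · intro x h1 h2 s
    dsimp only
    split_ifs <;> simp_all

lemma exchange_aux (μ : Measure ℝ) [IsFiniteMeasure μ] [NullSingletonClass μ]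
    (S : Finset ℕ) (A : ℕ → Set ℝ) (hA : ∀ t, MeasurableSet (A t)) (t0 : ℕ)
    (ht0 : t0 ∈ S) (B : Set ℝ) (hB : MeasurableSet B)
    (hpr : ∀ x ∈ B, ∀ x' ∉ B, cnt S A x' ≤ cnt S A x) (P : Finset (Finset ℕ × Finset ℕ)) :
    ∃ A' : ℕ → Set ℝ, (∀ s, MeasurableSet (A' s)) ∧ (∀ s, μ.real (A' s) = μ.real (A s)) ∧
      (∀ x, cnt S A' x = cnt S A x) ∧
      ∀ z ∈ P, μ.real (typ S A' z.1 ∩ (B \ A' t0)) = 0 ∨ μ.real (typ S A' z.2 ∩ (A' t0 \ B)) = 0 := by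
  classical
  induction P using Finset.induction_on with
  | empty => exact ⟨A, hA, fun _ => rfl, fun _ => rfl, by simp⟩
  | insert z P _ ih =>
    obtain ⟨A1, m1, r1, c1, p1⟩ := ih
    obtain ⟨α, β⟩ := z
    set D := typ S A1 α ∩ (B \ A1 t0) with hDdef
    set E := typ S A1 β ∩ (A1 t0 \ B) with hEdef
    have hDm : MeasurableSet D := (typ_meas S A1 m1 α).inter (hB.diff (m1 t0))
    have hEm : MeasurableSet E := (typ_meas S A1 m1 β).inter ((m1 t0).diff hB)
    by_cases hD0 : μ.real D = 0
    · refine ⟨A1, m1, r1, c1, ?_⟩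
      intro z hz
      rcases Finset.mem_insert.1 hz with rfl | hz
      · exact Or.inl hD0
      · exact p1 z hz
    by_cases hE0 : μ.real E = 0
    · refine ⟨A1, m1, r1, c1, ?_⟩
      intro z hz
      rcases Finset.mem_insert.1 hz with rfl | hz
      · exact Or.inr hE0
      · exact p1 z hz
    have hDn : D.Nonempty := by
      rw [Set.nonempty_iff_ne_empty]; intro h; exact hD0 (by simp [h])
    have hEn : E.Nonempty := by
      rw [Set.nonempty_iff_ne_empty]; intro h; exact hE0 (by simp [h])
    obtain ⟨x, hx1, hx2, hx3⟩ := hDn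
    obtain ⟨y, hy1, hy2, hy3⟩ := hEn
    have hle := hpr x hx2 y hy3
    rw [← c1, ← c1] at hle
    obtain ⟨t, htS, htx, hty⟩ : ∃ t ∈ S, x ∈ A1 t ∧ y ∉ A1 t := by
      by_contra! hcon
      refine absurd hle (not_le.2 ?_)
      unfold cnt
      apply Finset.card_lt_card
      rw [Finset.ssubset_iff_of_subset]
      · exact ⟨t0, by simp [ht0, hy2], by simp [hx3]⟩
      · intro t ht
        simp only [Finset.mem_filter] at ht ⊢
        exact ⟨ht.1, hcon t ht.1 ht.2⟩
    have htα : t ∈ α := (hx1 t htS).1 htx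
    have htβ : t ∉ β := fun h => hty ((hy1 t htS).2 h)
    obtain ⟨D', hD'D, hD'm, hD'r⟩ := split_set μ D hDm (min (μ.real D) (μ.real E))
      (by positivity) (min_le_left _ _)
    obtain ⟨E', hE'E, hE'm, hE'r⟩ := split_set μ E hEm (min (μ.real D) (μ.real E))
      (by positivity) (min_le_right _ _)
    obtain ⟨A2, m2, r2, c2, e2, u2⟩ := swap_step μ S A1 m1 t0 t ht0 htS D' E' hD'm hE'm
      (by
        rw [Set.eq_empty_iff_forall_notMem]
        intro w hw
        exact (hD'D hw.1).2.2 hw.2)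
      (fun w hw => ((hD'D hw).1 t htS).2 htα)
      (fun w hw => (hE'E hw).2.1)
      (by
        rw [Set.eq_empty_iff_forall_notMem]
        intro w hw
        exact htβ (((hE'E hw.1).1 t htS).1 hw.2))
      (by rw [hD'r, hE'r])
    have subD : ∀ γ, typ S A2 γ ∩ (B \ A2 t0) ⊆ (typ S A1 γ ∩ (B \ A1 t0)) \ D' := by
      rintro γ w ⟨hw1, hw2, hw3⟩
      have n1 : w ∉ D' := fun h => hw3 (by rw [e2]; exact Or.inr h)
      have n2 : w ∉ E' := fun h => (hE'E h).2.2 hw2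
      have := u2 w n1 n2
      exact ⟨⟨fun s hs => (this s).symm.trans (hw1 s hs), hw2, fun h => hw3 ((this _).2 h)⟩, n1⟩
    have subE : ∀ γ, typ S A2 γ ∩ (A2 t0 \ B) ⊆ (typ S A1 γ ∩ (A1 t0 \ B)) \ E' := by
      rintro γ w ⟨hw1, hw2, hw3⟩
      have n1 : w ∉ D' := fun h => hw3 (hD'D h).2.1
      have n2 : w ∉ E' := fun h => by
        rw [e2] at hw2
        exact hw2.elim (fun h' => h'.2 h) n1
      have := u2 w n1 n2
      exact ⟨⟨fun s hs => (this s).symm.trans (hw1 s hs), (this _).1 hw2, hw3⟩, n2⟩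
    have mono0 : ∀ U V : Set ℝ, U ⊆ V → μ.real V = 0 → μ.real U = 0 := fun U V h hV =>
      le_antisymm (hV ▸ measureReal_mono h) measureReal_nonneg
    refine ⟨A2, m2, fun s => (r2 s).trans (r1 s), fun x => (c2 x).trans (c1 x), ?_⟩
    intro z hz
    rcases Finset.mem_insert.1 hz with rfl | hz
    · rcases le_total (μ.real D) (μ.real E) with hle | hle
      · left
        apply mono0 _ _ (subD α)
        change μ.real (D \ D') = 0
        rw [measureReal_sdiff hD'D hD'm, hD'r, min_eq_left hle, sub_self]
      · right
        apply mono0 _ _ (subE β)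
        change μ.real (E \ E') = 0
        rw [measureReal_sdiff hE'E hE'm, hE'r, min_eq_right hle, sub_self]
    · rcases p1 z hz with h | h
      · exact Or.inl (mono0 _ _ ((subD _).trans Set.sdiff_subset) h)
      · exact Or.inr (mono0 _ _ ((subE _).trans Set.sdiff_subset) h)

lemma exchange (μ : Measure ℝ) [IsFiniteMeasure μ] [NullSingletonClass μ]
    (S : Finset ℕ) (A : ℕ → Set ℝ) (hA : ∀ t, MeasurableSet (A t)) (t0 : ℕ)
    (ht0 : t0 ∈ S) (B : Set ℝ) (hB : MeasurableSet B)
    (hpr : ∀ x ∈ B, ∀ x' ∉ B, cnt S A x' ≤ cnt S A x) (hBm : μ.real B = μ.real (A t0)) :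
    ∃ A' : ℕ → Set ℝ, (∀ s, MeasurableSet (A' s)) ∧ (∀ s, μ.real (A' s) = μ.real (A s)) ∧
      (∀ x, cnt S A' x = cnt S A x) ∧ ∀ᵐ x ∂μ, x ∈ A' t0 ↔ x ∈ B := by
  classical
  obtain ⟨A', m, r, c, hp⟩ := exchange_aux μ S A hA t0 ht0 B hB hpr (S.powerset ×ˢ S.powerset)
  refine ⟨A', m, r, c, ?_⟩
  have cover : ∀ U : Set ℝ, (∀ α ∈ S.powerset, μ.real (typ S A' α ∩ U) = 0) → μ.real U = 0 := by
    intro U hU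
    have : μ (⋃ α ∈ S.powerset, typ S A' α ∩ U) = 0 := by
      refine (measure_biUnion_null_iff (Finset.countable_toSet _)).2 fun α hα => ?_
      exact (measureReal_eq_zero_iff).1 (hU α hα)
    rw [measureReal_eq_zero_iff]
    refine measure_mono_null ?_ this
    intro x hx
    simp only [Set.mem_iUnion]
    refine ⟨S.filter fun t => x ∈ A' t, by simp, ?_, hx⟩
    intro t ht
    simp [ht]
  have h1 := measureReal_inter_add_sdiff (μ := μ) (s := B) (m t0)
  have h2 := measureReal_inter_add_sdiff (μ := μ) (s := A' t0) hB
  rw [Set.inter_comm] at h2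
  have h3 := r t0
  have heq : μ.real (B \ A' t0) = μ.real (A' t0 \ B) := by linarith
  have hz : μ.real (B \ A' t0) = 0 := by
    by_contra hne
    have a1 : ∃ α ∈ S.powerset, μ.real (typ S A' α ∩ (B \ A' t0)) ≠ 0 := by
      by_contra! hcon; exact hne (cover _ hcon)
    have a2 : ∃ α ∈ S.powerset, μ.real (typ S A' α ∩ (A' t0 \ B)) ≠ 0 := by
      by_contra! hcon; exact hne (heq ▸ cover _ hcon)
    obtain ⟨α, hα, a1⟩ := a1
    obtain ⟨β, hβ, a2⟩ := a2
    exact (hp (α, β) (Finset.mk_mem_product hα hβ)).elim a1 a2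
  have hz2 := heq ▸ hz
  rw [measureReal_eq_zero_iff] at hz hz2
  rw [measure_eq_zero_iff_ae_notMem] at hz hz2
  filter_upwards [hz, hz2] with x h1 h2
  simp only [Set.mem_sdiff, not_and, not_not] at h1 h2
  exact ⟨h2, h1⟩

lemma priority_set (μ : Measure ℝ) [IsFiniteMeasure μ] [NullSingletonClass μ]
    (y : ℝ → ℕ) (hy : Measurable y) (N : ℕ) (hN : ∀ x, y x ≤ N) (c : ℝ) (h0 : 0 ≤ c)
    (h1 : c ≤ μ.real Set.univ) :
    ∃ (k : ℕ) (B : Set ℝ), MeasurableSet B ∧ μ.real B = c ∧ (∀ x, k < y x → x ∈ B) ∧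
      (∀ x ∈ B, k ≤ y x) := by
  classical
  have hex : ∃ k, μ.real {x | k < y x} ≤ c := ⟨N, by
    have : {x | N < y x} = ∅ := by ext x; simpa using hN x
    simpa [this] using h0⟩
  have hmeas : ∀ k, MeasurableSet {x | k < y x} := fun k => hy (measurableSet_Ioi (a := k))
  set k := Nat.find hex with hk
  have hk1 : μ.real {x | k < y x} ≤ c := Nat.find_spec hex
  have hk2 : c ≤ μ.real {x | k ≤ y x} := by
    rcases Nat.eq_zero_or_pos k with h | h
    · simpa [h] using h1
    · have := Nat.find_min hex (m := k - 1) (by omega)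
      have e : {x | k - 1 < y x} = {x | k ≤ y x} := by ext x; simp; omega
      rw [e] at this
      exact (not_le.1 this).le
  have hmk : MeasurableSet {x | y x = k} := hy (measurableSet_singleton k)
  have hun : {x | k ≤ y x} = {x | k < y x} ∪ {x | y x = k} := by ext x; simp; omega
  have hdis : Disjoint {x | k < y x} {x | y x = k} := by
    rw [Set.disjoint_left]; intro x; simp; omega
  rw [hun, measureReal_union hdis hmk] at hk2
  obtain ⟨F, hF, hFm, hFr⟩ := split_set μ {x | y x = k} hmk (c - μ.real {x | k < y x})
    (by linarith) (by linarith)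
  refine ⟨k, {x | k < y x} ∪ F, (hmeas k).union hFm, ?_, fun x hx => Or.inl hx, ?_⟩
  · rw [measureReal_union (hdis.mono_right hF) hFm, hFr]; ring
  · rintro x (hx | hx)
    · exact le_of_lt hx
    · exact (hF hx).ge

lemma cnt_congr (S : Finset ℕ) (A A' : ℕ → Set ℝ) (h : ∀ s ∈ S, A s = A' s) (x : ℝ) :
    cnt S A x = cnt S A' x := by
  rw [cnt_eq_sum, cnt_eq_sum]
  exact Finset.sum_congr rfl fun s hs => by rw [h s hs]

lemma main_ind (μ : Measure ℝ) [IsFiniteMeasure μ] [NullSingletonClass μ] (n : ℕ) :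
    ∀ (a : ℕ) (A : ℕ → Set ℝ), (∀ t, MeasurableSet (A t)) →
    ∃ A' : ℕ → Set ℝ, (∀ s, MeasurableSet (A' s)) ∧ (∀ s, μ.real (A' s) = μ.real (A s)) ∧
      (∀ x, cnt (Finset.Ico a (a + n)) A' x = cnt (Finset.Ico a (a + n)) A x) ∧
      ∀ t ∈ Finset.Ico a (a + n), ∃ k, ∀ᵐ x ∂μ,
        (k < cnt (Finset.Ico t (a + n)) A' x → x ∈ A' t) ∧
        (x ∈ A' t → k ≤ cnt (Finset.Ico t (a + n)) A' x) := by
  induction n with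
  | zero => intro a A hA; exact ⟨A, hA, fun _ => rfl, fun _ => rfl, by simp⟩
  | succ n ih =>
    intro a A hA
    set S := Finset.Ico a (a + (n + 1)) with hS
    obtain ⟨k, B, hB, hBr, hB1, hB2⟩ := priority_set μ (cnt S A) (cnt_meas S A hA) S.card
      (fun x => by classical exact Finset.card_filter_le _ _) (μ.real (A a)) measureReal_nonneg
      (measureReal_mono (Set.subset_univ _))
    obtain ⟨A1, m1, r1, c1, p1⟩ := exchange μ S A hA a (by simp [hS]) B hB
      (fun x hx x' hx' => le_trans (not_lt.1 fun h => hx' (hB1 _ h)) (hB2 x hx)) hBr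
    obtain ⟨A2, m2, r2, c2, p2⟩ := ih (a + 1) A1 m1
    have he : a + 1 + n = a + (n + 1) := by ring
    rw [he] at c2 p2
    let A3 : ℕ → Set ℝ := fun s => if s = a then A1 a else A2 s
    have hA3 : ∀ t, a + 1 ≤ t → ∀ x, cnt (Finset.Ico t (a + (n+1))) A3 x =
        cnt (Finset.Ico t (a + (n+1))) A2 x := by
      intro t ht x
      apply cnt_congr
      intro s hs
      have : s ≠ a := by simp at hs; omega
      simp [A3, this]
    have hc3 : ∀ x, cnt S A3 x = cnt S A1 x := by
      intro x
      have hins : S = insert a (Finset.Ico (a+1) (a + (n+1))) := by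
        ext s; simp [hS]; omega
      have h2 := c2 x
      rw [← hA3 (a+1) le_rfl, cnt_eq_sum, cnt_eq_sum] at h2
      rw [hins, cnt_eq_sum, cnt_eq_sum, Finset.sum_insert (by simp), Finset.sum_insert (by simp), h2]
      simp [A3]
    refine ⟨A3, ?_, ?_, fun x => (hc3 x).trans (c1 x), ?_⟩
    · intro s; by_cases h : s = a
      · simpa [A3, h] using m1 a
      · simpa [A3, h] using m2 s
    · intro s; by_cases h : s = a
      · simpa [A3, h] using r1 a
      · simpa [A3, h] using (r2 s).trans (r1 s)
    · intro t ht
      by_cases h : t = a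
      · subst h
        refine ⟨k, ?_⟩
        filter_upwards [p1] with x hx
        rw [hc3, c1]
        have : A3 t = A1 t := by simp [A3]
        rw [this, hx]
        exact ⟨hB1 x, hB2 x⟩
      · have hta : a + 1 ≤ t := by simp [hS] at ht; omega
        obtain ⟨k', hk'⟩ := p2 t (by simp [hS] at ht ⊢; omega)
        refine ⟨k', ?_⟩
        filter_upwards [hk'] with x hx
        rw [hA3 t hta]
        have : A3 t = A2 t := by simp [A3, h]
        rwa [this]

/-- Theorem 3 (Longest-Leftover-Duration-First allocation, priority form):
if the nonincreasing supply profile `p` is simply adequate for loads `(ℓ, h)`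
and `q` is any permutation of `p` (the supply time profile), then there is a
measurable `{0,1}`-valued allocation `A` which (i) uses at most `q_t` power in
every slot `t`, (ii) serves every load for its full duration `h(x)` a.e., and
(iii) at every slot `t` gives priority to loads with strictly longer leftover
duration `y_t(x) = h(x) − ∑_{s=1}^{t−1} A(x,s)`: for a.e. pair `(x, x′)`, if
`y_t(x) > y_t(x′)` and `x′` is served at `t`, then so is `x`. -/
theorem lldf_allocation (T : ℕ) (hT : 1 ≤ T)
    (ℓ : ℝ → ℝ) (h : ℝ → ℕ)
    (hℓmeas : Measurable ℓ) (hℓpos : ∀ x, 0 < ℓ x)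
    (hℓint : IntegrableOn ℓ (Set.Icc (0 : ℝ) 1))
    (hhmeas : Measurable h) (hhrange : ∀ x, h x ∈ Finset.Icc 1 T)
    (p : ℕ → ℝ)
    (hpmono : ∀ s t : ℕ, 1 ≤ s → s ≤ t → t ≤ T → p t ≤ p s)
    (hpnonneg : ∀ t ∈ Finset.Icc 1 T, 0 ≤ p t)
    (q : ℕ → ℝ)
    (hq : ∃ σ : Equiv.Perm ℕ,
      (∀ i ∈ Finset.Icc 1 T, σ i ∈ Finset.Icc 1 T) ∧
      (∀ i ∈ Finset.Icc 1 T, q i = p (σ i)))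
    (hadeq : SimplyAdequate T ℓ h p) :
    ∃ A : ℝ → ℕ → ℝ,
      (∀ t : ℕ, Measurable fun x => A x t) ∧
      (∀ x : ℝ, ∀ t : ℕ, A x t = 0 ∨ A x t = 1) ∧
      (∀ t ∈ Finset.Icc 1 T, (∫ x in Set.Icc (0 : ℝ) 1, ℓ x * A x t) ≤ q t) ∧
      (∀ᵐ x ∂(volume.restrict (Set.Icc (0 : ℝ) 1)),
        ∑ t ∈ Finset.Icc 1 T, A x t = (h x : ℝ)) ∧
      (∀ t ∈ Finset.Icc 1 T,
        ∀ᵐ z ∂((volume.restrict (Set.Icc (0 : ℝ) 1)).prod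
            (volume.restrict (Set.Icc (0 : ℝ) 1))),
          ((h z.2 : ℝ) - ∑ s ∈ Finset.Icc 1 (t - 1), A z.2 s
              < (h z.1 : ℝ) - ∑ s ∈ Finset.Icc 1 (t - 1), A z.1 s) →
            A z.2 t = 1 → A z.1 t = 1) := by
  classical
  obtain ⟨σ, hσ1, hσ2⟩ := hq
  obtain ⟨A0, hA0m, hA01, hA0i, hA0s⟩ := hadeq
  set ν := volume.restrict (Set.Icc (0 : ℝ) 1) with hν
  set μ := ν.withDensity (fun x => ENNReal.ofReal (ℓ x)) with hμ
  have : IsFiniteMeasure μ := isFiniteMeasure_withDensity_ofReal hℓint.2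
  have hac : ν ≪ μ := withDensity_absolutelyContinuous' hℓmeas.ennreal_ofReal.aemeasurable
    (Filter.Eventually.of_forall fun x => by simpa using hℓpos x)
  have hreal : ∀ U : Set ℝ, MeasurableSet U →
      ∫ x, ℓ x * U.indicator (fun _ => (1:ℝ)) x ∂ν = μ.real U := by
    intro U hU
    have e : (fun x => ℓ x * U.indicator (fun _ => (1:ℝ)) x) = U.indicator ℓ := by
      funext x; by_cases hx : x ∈ U <;> simp [hx]
    rw [e, integral_indicator hU, measureReal_def, hμ, withDensity_apply _ hU,
      integral_eq_lintegral_of_nonneg_ae (Filter.Eventually.of_forall fun x => (hℓpos x).le)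
        hℓmeas.aestronglyMeasurable]
  let A : ℕ → Set ℝ := fun t => {x | A0 x (σ t) = 1}
  have hAm : ∀ t, MeasurableSet (A t) := fun t => hA0m (σ t) (measurableSet_singleton 1)
  have hAind : ∀ x t, A0 x (σ t) = (A t).indicator (fun _ => (1:ℝ)) x := by
    intro x t
    rcases hA01 x (σ t) with h | h <;> simp [A, Set.indicator_apply, h]
  obtain ⟨A', m', r', c', p'⟩ := main_ind μ T 1 A hAm
  have hIco : Finset.Ico 1 (1 + T) = Finset.Icc 1 T := by ext; simp; omega
  have hcast : ∀ (S : Finset ℕ) (C : ℕ → Set ℝ) (x : ℝ),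
      ∑ t ∈ S, (C t).indicator (fun _ => (1:ℝ)) x = (cnt S C x : ℝ) := by
    intro S C x
    rw [cnt_eq_sum, Nat.cast_sum]
    exact Finset.sum_congr rfl fun t _ => by by_cases hx : x ∈ C t <;> simp [hx]
  have hsum : ∀ᵐ x ∂ν, ∑ t ∈ Finset.Icc 1 T, (A' t).indicator (fun _ => (1:ℝ)) x = (h x : ℝ) := by
    filter_upwards [hA0s] with x hx
    have himg : (Finset.Icc 1 T).image σ = Finset.Icc 1 T := by
      apply Finset.eq_of_subset_of_card_le
      · intro s hs
        obtain ⟨i, hi, rfl⟩ := Finset.mem_image.1 hs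
        exact hσ1 i hi
      · rw [Finset.card_image_of_injective _ σ.injective]
    rw [← hx, hcast, ← hIco, c', ← hcast, hIco]
    conv_rhs => rw [← himg, Finset.sum_image (fun a _ b _ hab => σ.injective hab)]
    exact Finset.sum_congr rfl fun t _ => (hAind x t).symm
  refine ⟨fun x t => (A' t).indicator (fun _ => (1:ℝ)) x, ?_, ?_, ?_, hsum, ?_⟩
  · exact fun t => measurable_const.indicator (m' t)
  · intro x t
    by_cases hx : x ∈ A' t <;> simp [hx]
  · intro t ht
    rw [hreal _ (m' t), r' t, ← hreal _ (hAm t), hσ2 t ht]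
    refine le_trans (le_of_eq ?_) (hA0i (σ t) (hσ1 t ht))
    exact integral_congr_ae (Filter.Eventually.of_forall fun x => by simp only [hAind])
  · intro t ht
    obtain ⟨k, hk⟩ := p' t (hIco ▸ ht)
    have hk := hac.ae_le hk
    have hall : ∀ᵐ x ∂ν,
        ((h x : ℝ) - ∑ s ∈ Finset.Icc 1 (t - 1), (A' s).indicator (fun _ => (1:ℝ)) x
          = (cnt (Finset.Ico t (1 + T)) A' x : ℝ)) ∧
        (k < cnt (Finset.Ico t (1 + T)) A' x → x ∈ A' t) ∧
        (x ∈ A' t → k ≤ cnt (Finset.Ico t (1 + T)) A' x) := by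
      filter_upwards [hsum, hk] with x hx hkx
      refine ⟨?_, hkx⟩
      rw [Finset.mem_Icc] at ht
      have hI : Finset.Icc 1 (t - 1) = Finset.Ico 1 t := by ext; simp; omega
      rw [← hx, ← hIco, hI, ← Finset.sum_Ico_consecutive _ ht.1 (show t ≤ 1 + T by omega),
        add_sub_cancel_left, hcast]
    have f1 := Measure.quasiMeasurePreserving_fst (μ := ν) (ν := ν) |>.ae hall
    have f2 := Measure.quasiMeasurePreserving_snd (μ := ν) (ν := ν) |>.ae hall
    filter_upwards [f1, f2] with z h1 h2 hlt hz
    rw [h1.1, h2.1, Nat.cast_lt] at hlt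
    have hz2 : z.2 ∈ A' t := by
      by_contra hn
      simp [hn] at hz
    have hz1 : z.1 ∈ A' t := h1.2.1 (lt_of_le_of_lt (h2.2.2 hz2) hlt)
    simp [hz1]
end

section
/- Existence of Lagrange multipliers with complementary slackness for the welfare problem: let U be a bounded measurable utility function, p a nonincreasing nonnegative supply profile, and suppose there exists a feasible allocation with ∑_{i=t}^T d_i < ∑_{i=t}^T p_i strictly for all t (Slater condition). Let (ℓ*, h*) be a welfare-maximizing feasible allocation with attainable vector z* = ( ∫ U(x,ℓ*(x),h*(x))dx, z*_1, …, z*_T ) where z*_t = ∫_0^1 ℓ*(x)[h*(x)+1−t]_+ dx. Then there exist nonnegative numbers λ_1,…,λ_T such that (i) z* maximizes z_0 − ∑_{t=1}^T λ_t z_t over all z = (z_0, z_1,…,z_T) in the attainable set G, and (ii) λ_t ( z*_t − ∑_{i=t}^T p_i ) = 0 for every t = 1,…,T. -/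
open MeasureTheory

/-- An allocation `(ℓ, h)`: measurable, `ℓ ≥ 0` integrable, `h(x) ∈ {1,…,T}`. -/
def IsAllocation (T : ℕ) (ℓ : ℝ → ℝ) (h : ℝ → ℕ) : Prop :=
  Measurable ℓ ∧ Measurable h ∧ (∀ x, 0 ≤ ℓ x) ∧
  IntegrableOn ℓ (Set.Icc (0 : ℝ) 1) ∧ (∀ x, h x ∈ Finset.Icc 1 T)

/-- Feasibility of an allocation for the supply profile `p`: the tail sums of
its demand profile `d_i = ∫_0^1 ℓ(x) 1{h(x) ≥ i} dx` are dominated by those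
of `p`. -/
def FeasibleAllocation (T : ℕ) (ℓ : ℝ → ℝ) (h : ℝ → ℕ) (p : ℕ → ℝ) : Prop :=
  IsAllocation T ℓ h ∧
  ∀ t ∈ Finset.Icc 1 T,
    ∑ i ∈ Finset.Icc t T,
        (∫ x in Set.Icc (0 : ℝ) 1, ℓ x * (if i ≤ h x then (1 : ℝ) else 0))
      ≤ ∑ i ∈ Finset.Icc t T, p i

/-- The measure on consumers: Lebesgue measure on `[0,1]`. -/
noncomputable abbrev muI : Measure ℝ := volume.restrict (Set.Icc (0 : ℝ) 1)

lemma exists_cut (E : Set ℝ) (hE : MeasurableSet E) (θ : ℝ) (h0 : 0 ≤ θ) (h1 : θ ≤ 1) :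
    ∃ c : ℝ, muI.real (E ∩ Set.Iic c) = θ * muI.real E := by
  let g : ℝ → ℝ := fun c => ∫ x in (0:ℝ)..c, E.indicator (fun _ => (1:ℝ)) x
  have hint : ∀ a b : ℝ, IntervalIntegrable (E.indicator (fun _ => (1:ℝ))) volume a b := by
    intro a b
    constructor
    · exact (integrable_const (1:ℝ)).indicator hE
    · exact (integrable_const (1:ℝ)).indicator hE
  have hcont : Continuous g := intervalIntegral.continuous_primitive hint 0
  have hg : ∀ c ∈ Set.Icc (0:ℝ) 1, g c = muI.real (E ∩ Set.Iic c) := by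
    intro c hc
    change (∫ x in (0:ℝ)..c, E.indicator (fun _ => (1:ℝ)) x) = _
    rw [intervalIntegral.integral_of_le hc.1, integral_indicator hE]
    simp only [integral_const, smul_eq_mul, mul_one]
    simp only [measureReal_def]
    congr 1
    rw [Measure.restrict_apply MeasurableSet.univ, Set.univ_inter, 
      Measure.restrict_apply hE, Measure.restrict_apply (hE.inter measurableSet_Iic)]
    apply measure_congr
    have : (Set.Ioc (0:ℝ) c : Set ℝ) =ᵐ[volume] Set.Icc 0 c := Ioc_ae_eq_Icc
    have h2 := (Filter.EventuallyEq.refl (ae volume) E).inter this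
    suffices h3 : E ∩ Set.Icc (0:ℝ) c = (E ∩ Set.Iic c) ∩ Set.Icc (0:ℝ) 1 by
      rw [← h3]; exact h2
    ext x
    simp only [Set.mem_inter_iff, Set.mem_Icc, Set.mem_Iic]
    constructor
    · rintro ⟨a, b, d⟩; exact ⟨⟨a, d⟩, b, d.trans hc.2⟩
    · rintro ⟨⟨a, d⟩, b, _⟩; exact ⟨a, b, d⟩
  have hg0 : g 0 = 0 := by simp [g]
  have hg1 : g 1 = muI.real E := by
    rw [hg 1 (by simp)]
    simp only [measureReal_def]
    congr 1
    rw [Measure.restrict_apply hE, Measure.restrict_apply (hE.inter measurableSet_Iic)]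
    congr 1
    ext x
    simp only [Set.mem_inter_iff, Set.mem_Icc, Set.mem_Iic]
    tauto
  have hm : (0:ℝ) ≤ muI.real E := measureReal_nonneg
  have := intermediate_value_Icc (zero_le_one (α := ℝ)) hcont.continuousOn
  have hmem : θ * muI.real E ∈ Set.Icc (g 0) (g 1) := by
    rw [hg0, hg1]
    exact ⟨by positivity, by nlinarith⟩
  obtain ⟨c, hc, hc'⟩ := this hmem
  exact ⟨c, by rw [← hg c hc, hc']⟩

/-- Approximate Lyapunov theorem. -/
lemma approx_lyapunov {E : Type*} [NormedAddCommGroup E] [NormedSpace ℝ E] [CompleteSpace E]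
    (f : ℝ → E) (hf : Integrable f muI) (θ : ℝ) (h0 : 0 ≤ θ) (h1 : θ ≤ 1)
    (ε : ℝ) (hε : 0 < ε) :
    ∃ A : Set ℝ, MeasurableSet A ∧ ‖(∫ x in A, f x ∂muI) - θ • ∫ x, f x ∂muI‖ < ε := by
  obtain ⟨s, hs, hsm⟩ := (memLp_one_iff_integrable.2 hf).exists_simpleFunc_eLpNorm_sub_lt
    ENNReal.one_ne_top (ε := ENNReal.ofReal (ε / 2)) (by simpa using hε)
  have hsi : Integrable s muI := memLp_one_iff_integrable.1 hsm
  have hd : Integrable (fun x => f x - s x) muI := hf.sub hsi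
  have hnorm : ∫ x, ‖f x - s x‖ ∂muI < ε / 2 := by
    rw [eLpNorm_one_eq_lintegral_enorm] at hs
    rw [integral_norm_eq_lintegral_enorm hd.aestronglyMeasurable]
    exact (ENNReal.lt_ofReal_iff_toReal_lt hs.ne_top).1 hs
  choose τ hτ using fun y : E => exists_cut (s ⁻¹' {y}) (s.measurableSet_preimage {y}) θ h0 h1
  let A : Set ℝ := {x | x ≤ (s.map τ) x}
  have hA : MeasurableSet A := measurableSet_le measurable_id (s.map τ).measurable
  refine ⟨A, hA, ?_⟩
  have hs_eq : ∫ x in A, s x ∂muI = θ • ∫ x, s x ∂muI := by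
    rw [SimpleFunc.integral_eq_sum s hsi.integrableOn, SimpleFunc.integral_eq_sum s hsi,
      Finset.smul_sum]
    refine Finset.sum_congr rfl fun y _ => ?_
    rw [smul_smul, ← hτ y]
    congr 1
    rw [measureReal_restrict_apply (s.measurableSet_preimage {y})]
    congr 1
    ext x
    simp only [A, Set.mem_inter_iff, Set.mem_preimage, Set.mem_singleton_iff, Set.mem_ofPred_eq,
      SimpleFunc.map_apply, Set.mem_Iic]
    constructor
    · rintro ⟨a, b⟩; exact ⟨a, a ▸ b⟩
    · rintro ⟨a, b⟩; exact ⟨a, a ▸ b⟩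
  have e1 : ∫ x in A, f x - s x ∂muI = (∫ x in A, f x ∂muI) - ∫ x in A, s x ∂muI :=
    integral_sub hf.integrableOn hsi.integrableOn
  have e2 : ∫ x, f x - s x ∂muI = (∫ x, f x ∂muI) - ∫ x, s x ∂muI := integral_sub hf hsi
  have e3 : (∫ x in A, f x ∂muI) - θ • ∫ x, f x ∂muI
      = (∫ x in A, f x - s x ∂muI) - θ • ∫ x, f x - s x ∂muI := by
    rw [e1, e2, hs_eq, smul_sub]; abel
  have b1 : ‖∫ x in A, f x - s x ∂muI‖ ≤ ∫ x, ‖f x - s x‖ ∂muI :=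
    (norm_integral_le_integral_norm _).trans
      (setIntegral_le_integral hd.norm (Filter.Eventually.of_forall fun x => norm_nonneg _))
  have b2 : ‖∫ x, f x - s x ∂muI‖ ≤ ∫ x, ‖f x - s x‖ ∂muI := norm_integral_le_integral_norm _
  rw [e3]
  refine (norm_sub_le _ _).trans_lt ?_
  rw [norm_smul, Real.norm_of_nonneg h0]
  nlinarith [norm_nonneg (∫ x, f x - s x ∂muI)]

/-- The integrand of the attainable vector. -/
noncomputable def Phi (T : ℕ) (U : ℝ → ℝ → ℕ → ℝ) (ℓ : ℝ → ℝ) (h : ℝ → ℕ) (x : ℝ) :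
    ℝ × ({t // t ∈ Finset.Icc 1 T} → ℝ) :=
  (U x (ℓ x) (h x), fun t => ℓ x * max ((h x : ℝ) + 1 - ((t : ℕ) : ℝ)) 0)

lemma integrable_U (T : ℕ) (U : ℝ → ℝ → ℕ → ℝ)
    (hUmeas : ∀ k : ℕ, Measurable fun q : ℝ × ℝ => U q.1 q.2 k)
    (hUbdd : ∃ C : ℝ, ∀ (x l : ℝ) (k : ℕ), |U x l k| ≤ C) (ℓ : ℝ → ℝ) (h : ℝ → ℕ)
    (ha : IsAllocation T ℓ h) : Integrable (fun x => U x (ℓ x) (h x)) muI := by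
  obtain ⟨C, hC⟩ := hUbdd
  have hm : Measurable (fun q : (ℝ × ℝ) × ℕ => U q.1.1 q.1.2 q.2) :=
    measurable_from_prod_countable_left hUmeas
  have : Measurable (fun x => U x (ℓ x) (h x)) :=
    hm.comp ((measurable_id.prodMk ha.1).prodMk ha.2.1)
  exact Integrable.of_bound this.aestronglyMeasurable C
    (Filter.Eventually.of_forall fun x => hC _ _ _)

lemma integrable_lh (T : ℕ) (ℓ : ℝ → ℝ) (h : ℝ → ℕ)
    (ha : IsAllocation T ℓ h) (φ : ℕ → ℝ) : Integrable (fun x => ℓ x * φ (h x)) muI := by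
  have hm : Measurable fun x => φ (h x) := (measurable_from_nat (f := φ)).comp ha.2.1
  have hi : Integrable ℓ muI := ha.2.2.2.1
  refine hi.mul_bdd (c := ∑ k ∈ Finset.Icc 1 T, |φ k|) hm.aestronglyMeasurable
    (Filter.Eventually.of_forall fun x => ?_)
  exact Finset.single_le_sum (f := fun k => |φ k|) (fun _ _ => abs_nonneg _) (ha.2.2.2.2 x)

lemma integrable_Phi (T : ℕ) (U : ℝ → ℝ → ℕ → ℝ)
    (hUmeas : ∀ k : ℕ, Measurable fun q : ℝ × ℝ => U q.1 q.2 k)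
    (hUbdd : ∃ C : ℝ, ∀ (x l : ℝ) (k : ℕ), |U x l k| ≤ C) (ℓ : ℝ → ℝ) (h : ℝ → ℕ)
    (ha : IsAllocation T ℓ h) : Integrable (Phi T U ℓ h) muI := by
  refine Integrable.prodMk (integrable_U T U hUmeas hUbdd ℓ h ha) ?_
  refine Integrable.of_eval fun t => ?_
  exact integrable_lh T ℓ h ha (fun k => max ((k : ℝ) + 1 - ((t : ℕ) : ℝ)) 0)

lemma tail_eq (T : ℕ) (ℓ : ℝ → ℝ) (h : ℝ → ℕ) (ha : IsAllocation T ℓ h) (t : ℕ) :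
    ∑ i ∈ Finset.Icc t T,
        (∫ x in Set.Icc (0 : ℝ) 1, ℓ x * (if i ≤ h x then (1 : ℝ) else 0))
      = ∫ x in Set.Icc (0 : ℝ) 1, ℓ x * max ((h x : ℝ) + 1 - (t : ℝ)) 0 := by
  rw [← integral_finsetSum _ (fun i _ =>
    integrable_lh T ℓ h ha (fun k => if i ≤ k then (1:ℝ) else 0))]
  refine integral_congr_ae (Filter.Eventually.of_forall fun x => ?_)
  simp only
  rw [← Finset.mul_sum]
  congr 1
  have hx := Finset.mem_Icc.1 (ha.2.2.2.2 x)
  rw [Finset.sum_ite, Finset.sum_const_zero, add_zero, Finset.sum_const, nsmul_eq_mul, mul_one]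
  have : (Finset.Icc t T).filter (fun i => i ≤ h x) = Finset.Icc t (h x) := by
    ext i; simp only [Finset.mem_filter, Finset.mem_Icc]; omega
  rw [this, Nat.card_Icc]
  rcases le_total t (h x + 1) with hle | hle
  · rw [Nat.cast_sub hle, max_eq_left]
    · push_cast; ring
    · have : (t : ℝ) ≤ h x + 1 := by exact_mod_cast hle
      linarith
  · rw [Nat.sub_eq_zero_of_le hle, max_eq_right]
    · simp
    · have : (h x : ℝ) + 1 ≤ t := by exact_mod_cast hle
      linarith

/-- The attainable set with finitely many coordinates. -/
def Gfin (T : ℕ) (U : ℝ → ℝ → ℕ → ℝ) : Set (ℝ × ({t // t ∈ Finset.Icc 1 T} → ℝ)) :=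
  {z | ∃ ℓ h, IsAllocation T ℓ h ∧ z = ∫ x, Phi T U ℓ h x ∂muI}

lemma convex_closure_Gfin (T : ℕ) (U : ℝ → ℝ → ℕ → ℝ)
    (hUmeas : ∀ k : ℕ, Measurable fun q : ℝ × ℝ => U q.1 q.2 k)
    (hUbdd : ∃ C : ℝ, ∀ (x l : ℝ) (k : ℕ), |U x l k| ≤ C) :
    Convex ℝ (closure (Gfin T U)) := by
  have key : ∀ z ∈ Gfin T U, ∀ w ∈ Gfin T U, ∀ a b : ℝ, 0 ≤ a → 0 ≤ b → a + b = 1 →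
      a • z + b • w ∈ closure (Gfin T U) := by
    rintro z ⟨ℓ₁, h₁, ha₁, rfl⟩ w ⟨ℓ₂, h₂, ha₂, rfl⟩ a b h0 hb hab
    rw [Metric.mem_closure_iff]
    intro ε hε
    have i1 := integrable_Phi T U hUmeas hUbdd ℓ₁ h₁ ha₁
    have i2 := integrable_Phi T U hUmeas hUbdd ℓ₂ h₂ ha₂
    obtain ⟨A, hA, hAε⟩ := approx_lyapunov (fun x => Phi T U ℓ₁ h₁ x - Phi T U ℓ₂ h₂ x)
      (i1.sub i2) a h0 (by linarith) ε hε
    classical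
    have hal : IsAllocation T (A.piecewise ℓ₁ ℓ₂) (A.piecewise h₁ h₂) := by
      refine ⟨ha₁.1.piecewise hA ha₂.1, ha₁.2.1.piecewise hA ha₂.2.1, fun x => ?_, ?_, fun x => ?_⟩
      · by_cases hx : x ∈ A
        · simpa [hx] using ha₁.2.2.1 x
        · simpa [hx] using ha₂.2.2.1 x
      · exact Integrable.piecewise hA ha₁.2.2.2.1.integrableOn ha₂.2.2.2.1.integrableOn
      · by_cases hx : x ∈ A
        · simpa only [Set.piecewise_eq_of_mem _ _ _ hx] using ha₁.2.2.2.2 x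
        · simpa only [Set.piecewise_eq_of_notMem _ _ _ hx] using ha₂.2.2.2.2 x
    refine ⟨_, ⟨_, _, hal, rfl⟩, ?_⟩
    have e1 : ∫ x, Phi T U (A.piecewise ℓ₁ ℓ₂) (A.piecewise h₁ h₂) x ∂muI
        = (∫ x in A, (Phi T U ℓ₁ h₁ x - Phi T U ℓ₂ h₂ x) ∂muI) + ∫ x, Phi T U ℓ₂ h₂ x ∂muI := by
      have i3 : Integrable (A.indicator fun x => Phi T U ℓ₁ h₁ x - Phi T U ℓ₂ h₂ x) muI :=
        (i1.sub i2).indicator hA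
      rw [← integral_indicator hA, ← integral_add i3 i2]
      refine integral_congr_ae (Filter.Eventually.of_forall fun x => ?_)
      by_cases hx : x ∈ A
      · simp [Phi, hx]
      · simp [Phi, hx]
    rw [integral_sub i1 i2] at hAε
    rw [dist_comm, dist_eq_norm, e1]
    have hb' : b = 1 - a := by linarith
    subst hb'
    refine lt_of_eq_of_lt (congrArg norm ?_) hAε
    module
  intro z hz w hw a b ha hb hab
  have := map_mem_closure₂ (f := fun z w => a • z + b • w) (u := closure (Gfin T U))
    (by fun_prop) hz hw (fun z hz w hw => key z hz w hw a b ha hb hab)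
  rwa [closure_closure] at this

lemma integral_Phi (T : ℕ) (U : ℝ → ℝ → ℕ → ℝ)
    (hUmeas : ∀ k : ℕ, Measurable fun q : ℝ × ℝ => U q.1 q.2 k)
    (hUbdd : ∃ C : ℝ, ∀ (x l : ℝ) (k : ℕ), |U x l k| ≤ C) (ℓ : ℝ → ℝ) (h : ℝ → ℕ)
    (ha : IsAllocation T ℓ h) :
    ∫ x, Phi T U ℓ h x ∂muI = (∫ x in Set.Icc (0 : ℝ) 1, U x (ℓ x) (h x),
      fun t : {t // t ∈ Finset.Icc 1 T} =>
        ∫ x in Set.Icc (0 : ℝ) 1, ℓ x * max ((h x : ℝ) + 1 - ((t : ℕ) : ℝ)) 0) := by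
  have hi := integrable_Phi T U hUmeas hUbdd ℓ h ha
  refine Prod.ext ?_ (funext fun t => ?_)
  · rw [fst_integral hi]; rfl
  · rw [snd_integral hi, eval_integral (fun t => hi.snd.eval t)]; rfl

/-- A continuous linear functional on the finite-dimensional space in coordinates. -/
lemma functional_coord {ι : Type*} [Fintype ι] [DecidableEq ι]
    (f : StrongDual ℝ (ℝ × (ι → ℝ))) (z : ℝ × (ι → ℝ)) :
    f z = z.1 * f (1, 0) + ∑ t, z.2 t * f (0, Pi.single t 1) := by
  have : z = z.1 • ((1, 0) : ℝ × (ι → ℝ)) + ∑ t, z.2 t • ((0, Pi.single t 1) : ℝ × (ι → ℝ)) := by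
    refine Prod.ext ?_ (funext fun s => ?_)
    · simp [Prod.fst_sum]
    · simp [Prod.snd_sum, Finset.sum_apply, Pi.single_apply]
  conv_lhs => rw [this]
  simp only [map_add, map_sum, map_smul, smul_eq_mul]

/-- Abstract Lagrange multipliers under a Slater condition. -/
lemma abstract_lagrange {ι : Type*} [Fintype ι] [DecidableEq ι]
    (K : Set (ℝ × (ι → ℝ))) (hK : Convex ℝ (closure K)) (P : ι → ℝ)
    (w : ℝ × (ι → ℝ)) (hw : w ∈ K) (hwP : ∀ t, w.2 t < P t)
    (z : ℝ × (ι → ℝ)) (hz : z ∈ K) (hzP : ∀ t, z.2 t ≤ P t)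
    (hopt : ∀ y ∈ K, (∀ t, y.2 t ≤ P t) → y.1 ≤ z.1) :
    ∃ lam : ι → ℝ, (∀ t, 0 ≤ lam t) ∧
      (∀ y ∈ K, y.1 - ∑ t, lam t * y.2 t ≤ z.1 - ∑ t, lam t * z.2 t) ∧
      ∀ t, lam t * (z.2 t - P t) = 0 := by
  let O : Set (ℝ × (ι → ℝ)) := Set.Ioi z.1 ×ˢ Set.univ.pi fun t => Set.Iio (P t)
  have hOo : IsOpen O := isOpen_Ioi.prod (isOpen_set_pi Set.finite_univ fun t _ => isOpen_Iio)
  have hOc : Convex ℝ O := (convex_Ioi _).prod (convex_pi fun t _ => convex_Iio _)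
  have hmem : ∀ y : ℝ × (ι → ℝ), z.1 < y.1 → (∀ t, y.2 t < P t) → y ∈ O :=
    fun y h1 h2 => ⟨h1, fun t _ => h2 t⟩
  have hdisj : Disjoint O (closure K) := by
    refine Disjoint.closure_right (Set.disjoint_left.2 fun y hy hyK => ?_) hOo
    exact absurd (hopt y hyK fun t => (hy.2 t trivial).le) (not_le.2 hy.1)
  obtain ⟨f, u, hfO, hfK⟩ := geometric_hahn_banach_open hOc hOo hK hdisj
  have hfK' : ∀ y ∈ K, u ≤ f y := fun y hy => hfK y (subset_closure hy)
  -- recession directions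
  have hrec : ∀ d : ℝ × (ι → ℝ), 0 ≤ d.1 → (∀ t, d.2 t ≤ 0) → f d ≤ 0 := by
    intro d hd1 hd2
    by_contra hpos
    rw [not_le] at hpos
    have hq : ∀ s : ℝ, 0 ≤ s → f (z.1 + 1, fun t => P t - 1) + s * f d < u := by
      intro s hs
      have := hfO ((z.1 + 1, fun t => P t - 1) + s • d) (hmem _ ?_ fun t => ?_)
      · simpa using this
      · have := mul_nonneg hs hd1
        simp only [Prod.fst_add, Prod.smul_fst, smul_eq_mul]; linarith
      · have := mul_nonneg hs (neg_nonneg.2 (hd2 t))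
        simp only [Prod.snd_add, Prod.smul_snd, Pi.add_apply, Pi.smul_apply, smul_eq_mul]
        linarith
    have h0 := hq 0 le_rfl
    have h1 := hq ((u - f (z.1 + 1, fun t => P t - 1)) / f d)
      (div_nonneg (by linarith) hpos.le)
    rw [div_mul_cancel₀ _ hpos.ne'] at h1
    linarith
  have hlim : f (z.1, P) ≤ u := by
    by_contra hgt
    rw [not_le] at hgt
    have hε : ∀ s : ℝ, 0 < s → f (z.1, P) + s * f (1, fun _ => -1) < u := by
      intro s hs
      have := hfO ((z.1, P) + s • (1, fun _ => -1)) (hmem _ (by simpa using hs) fun t => ?_)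
      · simpa only [map_add, map_smul, smul_eq_mul] using this
      · simpa using hs
    have hd := hrec (1, fun _ => -1) (by simp) (by simp)
    have hlt := hε 1 one_pos
    have hneg : 0 < - f (1, fun _ => -1) := by linarith
    have h1 := hε ((f (z.1, P) - u) / (- f (1, fun _ => -1)))
      (div_pos (by linarith) hneg)
    have : (f (z.1, P) - u) / (- f (1, fun _ => -1)) * f (1, fun _ => -1) = -(f (z.1, P) - u) := by
      rw [div_mul_eq_mul_div, div_eq_iff hneg.ne']; ring
    rw [this] at h1
    linarith
  have ha : ∀ t, 0 ≤ f (0, Pi.single t 1) := by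
    intro t
    have := hrec (-(0, Pi.single t 1)) (by simp) (fun s => by
      by_cases h : s = t
      · subst h; simp
      · simp [h])
    rw [map_neg] at this
    linarith
  have hc : f (1, 0) < 0 := by
    refine lt_of_le_of_ne (hrec (1, 0) (by simp) (by simp)) fun h0 => ?_
    have h1 := hfO (z.1 + 1, w.2) (hmem _ (by simp) hwP)
    have h2 := hfK' w hw
    rw [functional_coord, h0] at h1 h2
    simp only [mul_zero, zero_add] at h1 h2
    linarith
  have hfz := hfK' z hz
  have hterm : ∀ t ∈ Finset.univ, (z.2 t - P t) * f (0, Pi.single t 1) ≤ 0 := fun t _ =>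
    mul_nonpos_of_nonpos_of_nonneg (by linarith [hzP t]) (ha t)
  have hdiff : f z - f (z.1, P) = ∑ t, (z.2 t - P t) * f (0, Pi.single t 1) := by
    rw [functional_coord f z, functional_coord f (z.1, P)]
    simp only [sub_mul, Finset.sum_sub_distrib]
    ring
  have hle := Finset.sum_nonpos hterm
  have hsum : ∑ t, (z.2 t - P t) * f (0, Pi.single t 1) = 0 := by linarith
  have hzero := (Finset.sum_eq_zero_iff_of_nonpos hterm).1 hsum
  refine ⟨fun t => f (0, Pi.single t 1) / (- f (1, 0)), fun t =>
    div_nonneg (ha t) (by linarith), fun y hy => ?_, fun t => ?_⟩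
  · have h1 : f z ≤ f y := by linarith [hfK' y hy]
    have hval : ∀ v : ℝ × (ι → ℝ),
        v.1 - ∑ t, f (0, Pi.single t 1) / (- f (1, 0)) * v.2 t = f v / f (1, 0) := by
      intro v
      rw [functional_coord f v, add_div, mul_div_cancel_right₀ _ hc.ne, Finset.sum_div,
        sub_eq_add_neg, ← Finset.sum_neg_distrib]
      congr 1
      refine Finset.sum_congr rfl fun t _ => ?_
      rw [div_neg]; ring
    rw [hval, hval]
    exact div_le_div_of_nonpos_of_le hc.le h1
  · have := hzero t (Finset.mem_univ t)
    rw [div_mul_eq_mul_div, mul_comm, this, zero_div]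

/-- Existence of Lagrange multipliers with complementary slackness for the
welfare maximization problem, under a Slater condition: if `(ℓ*, h*)` is a
welfare-maximizing feasible allocation with attainable vector `z*`, then there
are nonnegative `λ_1,…,λ_T` such that `z*` maximizes `z_0 − ∑_t λ_t z_t` over
the attainable set `G` and `λ_t (z*_t − ∑_{i=t}^T p_i) = 0` for all `t`. -/
theorem lagrange_multipliers_exist (T : ℕ) (hT : 1 ≤ T)
    (U : ℝ → ℝ → ℕ → ℝ)
    (hUmeas : ∀ k : ℕ, Measurable fun q : ℝ × ℝ => U q.1 q.2 k)
    (hUbdd : ∃ C : ℝ, ∀ (x l : ℝ) (k : ℕ), |U x l k| ≤ C)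
    (hU0 : ∀ x : ℝ, U x 0 0 = 0)
    (p : ℕ → ℝ)
    (hpmono : ∀ s t : ℕ, 1 ≤ s → s ≤ t → t ≤ T → p t ≤ p s)
    (hpnonneg : ∀ t ∈ Finset.Icc 1 T, 0 ≤ p t)
    (G : Set (ℝ × (ℕ → ℝ)))
    (hG : G = {z : ℝ × (ℕ → ℝ) | ∃ ℓ : ℝ → ℝ, ∃ h : ℝ → ℕ,
      IsAllocation T ℓ h ∧
      z.1 = ∫ x in Set.Icc (0 : ℝ) 1, U x (ℓ x) (h x) ∧
      ∀ t : ℕ, z.2 t =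
        ∫ x in Set.Icc (0 : ℝ) 1, ℓ x * max ((h x : ℝ) + 1 - (t : ℝ)) 0})
    -- Slater condition: some allocation satisfies every constraint strictly
    (hslater : ∃ ℓ : ℝ → ℝ, ∃ h : ℝ → ℕ, IsAllocation T ℓ h ∧
      ∀ t ∈ Finset.Icc 1 T,
        ∑ i ∈ Finset.Icc t T,
            (∫ x in Set.Icc (0 : ℝ) 1, ℓ x * (if i ≤ h x then (1 : ℝ) else 0))
          < ∑ i ∈ Finset.Icc t T, p i)
    (ℓstar : ℝ → ℝ) (hstar : ℝ → ℕ)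
    (hfeas : FeasibleAllocation T ℓstar hstar p)
    (hopt : ∀ ℓ : ℝ → ℝ, ∀ h : ℝ → ℕ, FeasibleAllocation T ℓ h p →
      (∫ x in Set.Icc (0 : ℝ) 1, U x (ℓ x) (h x))
        ≤ ∫ x in Set.Icc (0 : ℝ) 1, U x (ℓstar x) (hstar x))
    (zstar : ℝ × (ℕ → ℝ))
    (hzstar₀ : zstar.1 = ∫ x in Set.Icc (0 : ℝ) 1, U x (ℓstar x) (hstar x))
    (hzstar : ∀ t : ℕ, zstar.2 t =
      ∫ x in Set.Icc (0 : ℝ) 1, ℓstar x * max ((hstar x : ℝ) + 1 - (t : ℝ)) 0) :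
    ∃ lam : ℕ → ℝ,
      (∀ t ∈ Finset.Icc 1 T, 0 ≤ lam t) ∧
      (∀ z ∈ G, z.1 - ∑ t ∈ Finset.Icc 1 T, lam t * z.2 t
        ≤ zstar.1 - ∑ t ∈ Finset.Icc 1 T, lam t * zstar.2 t) ∧
      (∀ t ∈ Finset.Icc 1 T,
        lam t * (zstar.2 t - ∑ i ∈ Finset.Icc t T, p i) = 0) := by
  have hP := fun (ℓ : ℝ → ℝ) (h : ℝ → ℕ) (ha : IsAllocation T ℓ h) =>
    integral_Phi T U hUmeas hUbdd ℓ h ha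
  obtain ⟨ℓs, hs, has, hslt⟩ := hslater
  have hstareq : ∫ x, Phi T U ℓstar hstar x ∂muI = ((zstar.1, fun t => zstar.2 t) : ℝ × ({t // t ∈ Finset.Icc 1 T} → ℝ)) := by
    rw [hP _ _ hfeas.1, hzstar₀]
    refine Prod.ext rfl (funext fun t => ?_)
    exact (hzstar t).symm
  obtain ⟨lam, hl0, hlmax, hlcs⟩ := abstract_lagrange (Gfin T U)
    (convex_closure_Gfin T U hUmeas hUbdd) (fun t => ∑ i ∈ Finset.Icc (t : ℕ) T, p i)
    _ ⟨ℓs, hs, has, rfl⟩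
    (fun t => by
      rw [hP _ _ has]
      have := hslt t t.2
      rwa [tail_eq T ℓs hs has] at this)
    ((zstar.1, fun t => zstar.2 t) : ℝ × ({t // t ∈ Finset.Icc 1 T} → ℝ)) ⟨ℓstar, hstar, hfeas.1, hstareq.symm⟩
    (fun t => by
      have := hfeas.2 t t.2
      rwa [tail_eq T ℓstar hstar hfeas.1, ← hzstar] at this)
    (by
      rintro y ⟨ℓ, h, ha, rfl⟩ hy
      rw [hP _ _ ha] at hy ⊢
      simp only at hy ⊢
      rw [hzstar₀]
      refine hopt ℓ h ⟨ha, fun t ht => ?_⟩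
      rw [tail_eq T ℓ h ha]
      exact hy ⟨t, ht⟩)
  have hsumeq : ∀ v : ℕ → ℝ, ∑ t ∈ Finset.Icc 1 T,
      (if ht : t ∈ Finset.Icc 1 T then lam ⟨t, ht⟩ else 0) * v t
      = ∑ t : {t // t ∈ Finset.Icc 1 T}, lam t * v t := by
    intro v
    rw [← Finset.sum_coe_sort]
    refine Finset.sum_congr rfl fun t _ => ?_
    rw [dif_pos t.2]
  refine ⟨fun t => if ht : t ∈ Finset.Icc 1 T then lam ⟨t, ht⟩ else 0, fun t ht => ?_,
    fun z hz => ?_, fun t ht => ?_⟩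
  · simp only [dif_pos ht]; exact hl0 _
  · rw [hG] at hz
    obtain ⟨ℓ, h, ha, hz1, hz2⟩ := hz
    rw [hsumeq, hsumeq]
    refine hlmax (z.1, fun t => z.2 t) ⟨ℓ, h, ha, ?_⟩
    rw [hP _ _ ha, hz1]
    exact Prod.ext rfl (funext fun t => hz2 t)
  · simp only [dif_pos ht]
    exact hlcs ⟨t, ht⟩
end

section
/- Structure of duration-differentiated equilibrium prices: let λ_1,…,λ_T be nonnegative reals and define prices π_h = ∑_{t=1}^{T} λ_t [h+1−t]_+ for h = 0,1,…,T. Then π_h − π_{h−1} = λ_1 + λ_2 + … + λ_h for every h = 1,…,T; consequently h ↦ π_h is nondecreasing and has nondecreasing increments (π_{h+1} − π_h ≥ π_h − π_{h−1}), and in particular π_{h1+h2} ≥ π_{h1} + π_{h2} for durations h1, h2 with h1 + h2 ≤ T. -/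
/-- Structure of duration-differentiated equilibrium prices: with
`π_h = ∑_{t=1}^T λ_t [h+1−t]_+` for nonnegative multipliers `λ_t`,
one has `π_h − π_{h−1} = λ_1 + … + λ_h`; hence `h ↦ π_h` is nondecreasing,
has nondecreasing increments, and is superadditive. -/
theorem price_structure (T : ℕ) (hT : 1 ≤ T) (lam : ℕ → ℝ)
    (hlam : ∀ t ∈ Finset.Icc 1 T, 0 ≤ lam t)
    (π : ℕ → ℝ)
    (hπ : ∀ h, π h = ∑ t ∈ Finset.Icc 1 T, lam t * max ((h : ℝ) + 1 - (t : ℝ)) 0) :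
    (∀ h ∈ Finset.Icc 1 T, π h - π (h - 1) = ∑ i ∈ Finset.Icc 1 h, lam i) ∧
    (∀ h₁ h₂ : ℕ, h₁ ≤ h₂ → h₂ ≤ T → π h₁ ≤ π h₂) ∧
    (∀ h : ℕ, 1 ≤ h → h + 1 ≤ T → π h - π (h - 1) ≤ π (h + 1) - π h) ∧
    (∀ h₁ h₂ : ℕ, 1 ≤ h₁ → 1 ≤ h₂ → h₁ + h₂ ≤ T → π h₁ + π h₂ ≤ π (h₁ + h₂)) := by
  have key : ∀ h ∈ Finset.Icc 1 T, π h - π (h - 1) = ∑ i ∈ Finset.Icc 1 h, lam i := by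
    intro h hh
    rw [Finset.mem_Icc] at hh
    have hsub : Finset.Icc 1 h ⊆ Finset.Icc 1 T := Finset.Icc_subset_Icc_right hh.2
    have hc : ((h - 1 : ℕ) : ℝ) = (h : ℝ) - 1 := by
      rw [Nat.cast_sub hh.1, Nat.cast_one]
    rw [hπ, hπ, ← Finset.sum_sub_distrib, hc, ← Finset.sum_subset hsub]
    · refine Finset.sum_congr rfl fun t ht => ?_
      have h1 : (t : ℝ) ≤ h := by exact_mod_cast (Finset.mem_Icc.1 ht).2
      rw [max_eq_left (by linarith), max_eq_left (by linarith)]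
      ring
    · intro t ht hn
      have h1 : h + 1 ≤ t := by
        simp only [Finset.mem_Icc] at ht hn
        omega
      have h2 : (h : ℝ) + 1 ≤ t := by exact_mod_cast h1
      rw [max_eq_right (by linarith), max_eq_right (by linarith)]
      ring
  refine ⟨key, ?_, ?_, ?_⟩
  · intro a b hab _
    rw [hπ, hπ]
    have h1 : (a : ℝ) ≤ b := by exact_mod_cast hab
    refine Finset.sum_le_sum fun t ht => mul_le_mul_of_nonneg_left ?_ (hlam t ht)
    exact max_le_max (by linarith) le_rfl
  · intro h h1 h2
    have e1 := key h (Finset.mem_Icc.2 ⟨h1, by omega⟩)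
    have e2 := key (h + 1) (Finset.mem_Icc.2 ⟨by omega, h2⟩)
    rw [Nat.add_sub_cancel, Finset.sum_Icc_succ_top (by omega)] at e2
    have := hlam (h + 1) (Finset.mem_Icc.2 ⟨by omega, h2⟩)
    linarith
  · intro a b _ _ _
    rw [hπ, hπ, hπ, ← Finset.sum_add_distrib]
    refine Finset.sum_le_sum fun t ht => ?_
    rw [← mul_add]
    refine mul_le_mul_of_nonneg_left ?_ (hlam t ht)
    have h1 : (1 : ℝ) ≤ t := by exact_mod_cast (Finset.mem_Icc.1 ht).1
    have ha : (0 : ℝ) ≤ a := Nat.cast_nonneg a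
    have hb : (0 : ℝ) ≤ b := Nat.cast_nonneg b
    push_cast
    have m1 := le_max_left ((a : ℝ) + b + 1 - t) 0
    have m2 := le_max_right ((a : ℝ) + b + 1 - t) 0
    rcases max_cases ((a : ℝ) + 1 - t) 0 with h | h <;>
      rcases max_cases ((b : ℝ) + 1 - t) 0 with h' | h' <;> linarith
end

section
/- Existence of an efficient competitive equilibrium (Theorem 6): let U be a bounded measurable utility function, p a nonincreasing nonnegative supply profile, and suppose the welfare maximum is attained at a feasible allocation (ℓ*, h*) and that nonnegative Lagrange multipliers λ_1,…,λ_T exist satisfying the maximization property over the attainable set G and complementary slackness. Define prices π_h = ∑_{t=1}^T λ_t [h+1−t]_+. Then: (i) for almost every consumer x, (ℓ*(x), h*(x)) maximizes U(x, ℓ, h) − π_h ℓ over ℓ ≥ 0 and h ∈ {1,…,T} (consumer welfare maximization); (ii) the bundle L_h = ∫_0^1 ℓ*(x) 1{h*(x) = h} dx maximizes the supplier's revenue ∑_h L′_h π_h over all feasible bundles L′ (supplier revenue maximization); and (iii) the market clears. Hence the prices π_1,…,π_T together with the allocation (ℓ*, h*) constitute a competitive equilibrium whose allocation maximizes social welfare.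 -/
open MeasureTheory

/-- A bundle `L = (L_1,…,L_T)` of duration-differentiated services is feasible
for the supply profile `p` if its demand profile `δ_k = ∑_{t=k}^T L_t`
satisfies `∑_{i=t}^T δ_i ≤ ∑_{i=t}^T p_i` for every `t`. -/
def FeasibleBundle (T : ℕ) (L : ℕ → ℝ) (p : ℕ → ℝ) : Prop :=
  (∀ k ∈ Finset.Icc 1 T, 0 ≤ L k) ∧
  ∀ t ∈ Finset.Icc 1 T,
    ∑ i ∈ Finset.Icc t T, (∑ k ∈ Finset.Icc i T, L k)
      ≤ ∑ i ∈ Finset.Icc t T, p i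


/-- Capacitability: a continuous image of Baire space of positive outer measure contains the
image of a compact box of positive measure. -/
lemma exists_box_pos (μ : Measure ℝ) [IsFiniteMeasure μ] (g : (ℕ → ℕ) → ℝ) (hg : Continuous g)
    (h : μ (Set.range g) ≠ 0) :
    ∃ n : ℕ → ℕ, μ (g '' {x | ∀ i, x i ≤ n i}) ≠ 0 := by
  obtain ⟨ε, hε0, hε⟩ := exists_between (pos_iff_ne_zero.2 h)
  have step : ∀ (k : ℕ) (C : Set (ℕ → ℕ)), ∃ m : ℕ,
      ε < μ (g '' C) → ε < μ (g '' (C ∩ {x | x k ≤ m})) := by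
    intro k C
    by_cases hC : ε < μ (g '' C)
    · have hmono : Monotone (fun m : ℕ => g '' (C ∩ {x | x k ≤ m})) := by
        intro a b hab
        apply Set.image_mono
        rintro x ⟨hx, hx'⟩
        exact ⟨hx, le_trans hx' hab⟩
      have hun : g '' C = ⋃ m : ℕ, g '' (C ∩ {x | x k ≤ m}) := by
        rw [← Set.image_iUnion]
        congr 1
        ext x
        simp only [Set.mem_iUnion, Set.mem_inter_iff, Set.mem_ofPred_eq]
        exact ⟨fun hx => ⟨x k, hx, le_rfl⟩, fun ⟨_, hx, _⟩ => hx⟩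
      have hC' := hC
      rw [hun, hmono.measure_iUnion] at hC'
      obtain ⟨m, hm⟩ := lt_iSup_iff.1 hC'
      exact ⟨m, fun _ => hm⟩
    · exact ⟨0, fun h' => absurd h' hC⟩
  choose m hm using step
  let C : ℕ → Set (ℕ → ℕ) := fun k =>
    Nat.rec Set.univ (fun k C => C ∩ {x | x k ≤ m k C}) k
  have hC0 : C 0 = Set.univ := rfl
  have hCs : ∀ k, C (k + 1) = C k ∩ {x | x k ≤ m k (C k)} := fun k => rfl
  have hCε : ∀ k, ε < μ (g '' C k) := by
    intro k
    induction k with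
    | zero => rw [hC0, Set.image_univ]; exact hε
    | succ k ih => rw [hCs]; exact hm k _ ih
  have hCanti : Antitone C := antitone_nat_of_succ_le (fun k => by
    rw [hCs]; exact Set.inter_subset_left)
  refine ⟨fun k => m k (C k), ?_⟩
  have hCle : ∀ k, ∀ x ∈ C k, ∀ i < k, x i ≤ m i (C i) := by
    intro k x hx i hi
    have := hCanti (show i + 1 ≤ k from hi) hx
    rw [hCs] at this
    exact this.2
  set n : ℕ → ℕ := fun k => m k (C k) with hn
  have hKc : IsCompact {x : ℕ → ℕ | ∀ i, x i ≤ n i} := by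
    have : {x : ℕ → ℕ | ∀ i, x i ≤ n i} = Set.pi Set.univ (fun i => Set.Iic (n i)) := by
      ext x; simp [Pi.le_def]
    rw [this]
    exact isCompact_univ_pi (fun i => (Set.finite_Iic _).isCompact)
  have hsub : (⋂ k, closure (g '' C k)) ⊆ g '' {x | ∀ i, x i ≤ n i} := by
    intro y hy
    have hy' : ∀ k : ℕ, ∃ x ∈ C k, dist y (g x) < 1 / ((k : ℝ) + 1) := by
      intro k
      have h1 := Metric.mem_closure_iff.1 (Set.mem_iInter.1 hy k) (1 / ((k : ℝ) + 1))
        (by positivity)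
      obtain ⟨b, ⟨x, hx, rfl⟩, hb⟩ := h1
      exact ⟨x, hx, hb⟩
    choose x hx hxd using hy'
    obtain ⟨a, ha, φ, hφ, hlim⟩ := hKc.tendsto_subseq
      (x := fun k i => min (x k i) (n i)) (fun k i => min_le_right _ _)
    have hlim2 : Filter.Tendsto (fun j => x (φ j)) Filter.atTop (nhds a) := by
      rw [tendsto_pi_nhds] at hlim ⊢
      intro i
      refine (hlim i).congr' ?_
      filter_upwards [Filter.eventually_gt_atTop i] with j hj
      have : i < φ j := lt_of_lt_of_le hj (hφ.id_le j)
      exact min_eq_left (hCle _ _ (hx (φ j)) i this)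
    have h1 : Filter.Tendsto (fun j => g (x (φ j))) Filter.atTop (nhds (g a)) :=
      (hg.tendsto a).comp hlim2
    have h2 : Filter.Tendsto (fun k => g (x k)) Filter.atTop (nhds y) := by
      rw [tendsto_iff_dist_tendsto_zero]
      refine squeeze_zero (fun _ => dist_nonneg) (fun k => ?_)
        tendsto_one_div_add_atTop_nhds_zero_nat
      rw [dist_comm]
      exact (hxd k).le
    exact ⟨a, ha, tendsto_nhds_unique h1 (h2.comp hφ.tendsto_atTop)⟩
  have hmeas : ε ≤ μ (⋂ k, closure (g '' C k)) := by
    rw [Antitone.measure_iInter]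
    · exact le_iInf fun k => (hCε k).le.trans (measure_mono subset_closure)
    · intro a b hab
      exact closure_mono (Set.image_mono (hCanti hab))
    · exact fun k => isClosed_closure.measurableSet.nullMeasurableSet
    · exact ⟨0, measure_ne_top _ _⟩
  exact (lt_of_lt_of_le hε0 (hmeas.trans (measure_mono hsub))).ne'

lemma exists_compact_proj_pos (μ : Measure ℝ) [IsFiniteMeasure μ] (B : Set (ℝ × ℝ))
    (hB : MeasurableSet B) (h : μ (Prod.fst '' B) ≠ 0) :
    ∃ K ⊆ B, IsCompact K ∧ μ (Prod.fst '' K) ≠ 0 := by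
  have hA := hB.analyticSet
  rw [AnalyticSet] at hA
  rcases hA with rfl | ⟨f, hf, rfl⟩
  · simp at h
  · rw [← Set.range_comp] at h
    obtain ⟨n, hn⟩ := exists_box_pos μ _ (continuous_fst.comp hf) h
    refine ⟨f '' {x | ∀ i, x i ≤ n i}, Set.image_subset_range _ _, ?_, ?_⟩
    · apply IsCompact.image _ hf
      have : {x : ℕ → ℕ | ∀ i, x i ≤ n i} = Set.pi Set.univ (fun i => Set.Iic (n i)) := by
        ext x; simp [Pi.le_def]
      rw [this]
      exact isCompact_univ_pi (fun i => (Set.finite_Iic _).isCompact)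
    · rwa [← Set.image_comp]

lemma exists_selection (K : Set (ℝ × ℝ)) (hK : IsCompact K) :
    ∃ s : ℝ → ℝ, Measurable s ∧ ∀ x ∈ Prod.fst '' K, (x, s x) ∈ K := by
  have hfib : ∀ x, IsCompact {l : ℝ | (x, l) ∈ K} := by
    intro x
    have : {l : ℝ | (x, l) ∈ K} = Prod.snd '' (K ∩ {q | q.1 = x}) := by
      ext l
      constructor
      · intro h; exact ⟨(x, l), ⟨h, rfl⟩, rfl⟩
      · rintro ⟨⟨a, b⟩, ⟨h, h'⟩, rfl⟩
        simp only [Set.mem_ofPred_eq] at h'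
        subst h'
        exact h
    rw [this]
    exact (hK.inter_right (isClosed_eq continuous_fst continuous_const)).image continuous_snd
  have hsel : ∀ x ∈ Prod.fst '' K, (x, sInf {l : ℝ | (x, l) ∈ K}) ∈ K := by
    rintro x ⟨⟨a, b⟩, h, rfl⟩
    exact (hfib a).sInf_mem ⟨b, h⟩
  refine ⟨fun x => sInf {l : ℝ | (x, l) ∈ K}, ?_, hsel⟩
  apply measurable_of_Iic
  intro a
  have hP : MeasurableSet (Prod.fst '' K) := (hK.image continuous_fst).measurableSet
  have hPa : MeasurableSet (Prod.fst '' (K ∩ {q | q.2 ≤ a})) :=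
    ((hK.inter_right (isClosed_le continuous_snd continuous_const)).image
      continuous_fst).measurableSet
  have : (fun x => sInf {l : ℝ | (x, l) ∈ K}) ⁻¹' Set.Iic a =
      Prod.fst '' (K ∩ {q | q.2 ≤ a}) ∪ ((Prod.fst '' K)ᶜ ∩ {_x | 0 ≤ a}) := by
    ext x
    by_cases hx : x ∈ Prod.fst '' K
    · simp only [Set.mem_preimage, Set.mem_Iic, Set.mem_union, Set.mem_inter_iff,
        Set.mem_compl_iff, hx, not_true_eq_false, false_and, or_false]
      constructor
      · intro h
        exact ⟨(x, _), ⟨hsel x hx, h⟩, rfl⟩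
      · rintro ⟨⟨c, b⟩, ⟨h, h'⟩, rfl⟩
        exact (csInf_le (hfib c).bddBelow h).trans h'
    · have hemp : {l : ℝ | (x, l) ∈ K} = ∅ := by
        ext l
        simp only [Set.mem_ofPred_eq, Set.mem_empty_iff_false, iff_false]
        exact fun h => hx ⟨_, h, rfl⟩
      have hx2 : x ∉ Prod.fst '' (K ∩ {q | q.2 ≤ a}) :=
        fun h => hx (Set.image_mono Set.inter_subset_left h)
      simp only [Set.mem_preimage, hemp, Real.sInf_empty, Set.mem_Iic, Set.mem_union,
        Set.mem_inter_iff, Set.mem_compl_iff, hx, hx2, not_false_eq_true, true_and, false_or,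
        Set.mem_ofPred_eq]
  rw [this]
  exact hPa.union (hP.compl.inter (MeasurableSet.const _))

lemma demand_sum (T : ℕ) (L : ℕ → ℝ) (t : ℕ) (ht : 1 ≤ t) :
    ∑ i ∈ Finset.Icc t T, (∑ k ∈ Finset.Icc i T, L k)
      = ∑ k ∈ Finset.Icc 1 T, L k * max ((k : ℝ) + 1 - (t : ℝ)) 0 := by
  rw [Finset.sum_comm' (t' := Finset.Icc t T) (s' := fun k => Finset.Icc t k)
    (by intro x y; simp only [Finset.mem_Icc]; omega)]
  have hsub : Finset.Icc t T ⊆ Finset.Icc 1 T := Finset.Icc_subset_Icc_left ht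
  rw [← Finset.sum_subset hsub]
  · apply Finset.sum_congr rfl
    intro k hk
    have hk' := (Finset.mem_Icc.1 hk).1
    have : (t : ℝ) ≤ k := by exact_mod_cast hk'
    rw [Finset.sum_const, Nat.card_Icc, nsmul_eq_mul, Nat.cast_sub (by omega),
      max_eq_left (by linarith)]
    push_cast
    ring
  · intro k hk hk'
    have : k + 1 ≤ t := by
      simp only [Finset.mem_Icc] at hk hk'
      omega
    have : (k : ℝ) + 1 ≤ t := by exact_mod_cast this
    rw [max_eq_right (by linarith), mul_zero]

lemma integrable_weight (T : ℕ) (ℓ : ℝ → ℝ) (h : ℝ → ℕ) (hA : IsAllocation T ℓ h)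
    (w : ℕ → ℝ) : IntegrableOn (fun x => ℓ x * w (h x)) (Set.Icc (0 : ℝ) 1) := by
  obtain ⟨_, hhm, _, hi, hh⟩ := hA
  refine Integrable.mul_bdd (c := ∑ k ∈ Finset.Icc 1 T, |w k|) hi
    ((measurable_from_top (f := w)).comp hhm).aestronglyMeasurable ?_
  refine Filter.Eventually.of_forall fun x => ?_
  exact Finset.single_le_sum (f := fun k => |w k|) (fun k _ => abs_nonneg _) (hh x)

lemma integral_weight (T : ℕ) (ℓ : ℝ → ℝ) (h : ℝ → ℕ) (hA : IsAllocation T ℓ h)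
    (w : ℕ → ℝ) : ∫ x in Set.Icc (0 : ℝ) 1, ℓ x * w (h x) =
      ∑ k ∈ Finset.Icc 1 T,
        (∫ x in Set.Icc (0 : ℝ) 1, ℓ x * (if h x = k then (1 : ℝ) else 0)) * w k := by
  simp_rw [← integral_mul_const]
  rw [← integral_finsetSum]
  · congr 1
    ext x
    rw [Finset.sum_eq_single (h x)]
    · simp
    · intro k _ hk
      simp [hk.symm]
    · exact fun hx => absurd (hA.2.2.2.2 x) hx
  · intro k _
    exact (integrable_weight T ℓ h hA (fun j => if j = k then 1 else 0)).mul_const _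

lemma integrable_util (T : ℕ) (U : ℝ → ℝ → ℕ → ℝ)
    (hUmeas : ∀ k : ℕ, Measurable fun q : ℝ × ℝ => U q.1 q.2 k)
    (hUbdd : ∃ C : ℝ, ∀ (x l : ℝ) (k : ℕ), |U x l k| ≤ C)
    (ℓ : ℝ → ℝ) (h : ℝ → ℕ) (hA : IsAllocation T ℓ h) :
    Measurable (fun x => U x (ℓ x) (h x)) ∧
    IntegrableOn (fun x => U x (ℓ x) (h x)) (Set.Icc (0 : ℝ) 1) := by
  have hm : Measurable (fun x => U x (ℓ x) (h x)) := by
    have h1 : Measurable (fun q : (ℝ × ℝ) × ℕ => U q.1.1 q.1.2 q.2) :=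
      measurable_from_prod_countable_left hUmeas
    exact h1.comp ((measurable_id.prodMk hA.1).prodMk hA.2.1)
  refine ⟨hm, ?_⟩
  obtain ⟨C, hC⟩ := hUbdd
  exact Integrable.of_bound hm.aestronglyMeasurable C
    (Filter.Eventually.of_forall fun x => hC _ _ _)

lemma lagrangian_eq (T : ℕ) (U : ℝ → ℝ → ℕ → ℝ)
    (hUmeas : ∀ k : ℕ, Measurable fun q : ℝ × ℝ => U q.1 q.2 k)
    (hUbdd : ∃ C : ℝ, ∀ (x l : ℝ) (k : ℕ), |U x l k| ≤ C)
    (lam π : ℕ → ℝ)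
    (hπ : ∀ k : ℕ, π k = ∑ t ∈ Finset.Icc 1 T, lam t * max ((k : ℝ) + 1 - (t : ℝ)) 0)
    (ℓ : ℝ → ℝ) (h : ℝ → ℕ) (hA : IsAllocation T ℓ h) :
    IntegrableOn (fun x => U x (ℓ x) (h x) - π (h x) * ℓ x) (Set.Icc (0 : ℝ) 1) ∧
    ∫ x in Set.Icc (0 : ℝ) 1, (U x (ℓ x) (h x) - π (h x) * ℓ x) =
      (∫ x in Set.Icc (0 : ℝ) 1, U x (ℓ x) (h x)) - ∑ t ∈ Finset.Icc 1 T, lam t *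
        ∫ x in Set.Icc (0 : ℝ) 1, ℓ x * max ((h x : ℝ) + 1 - (t : ℝ)) 0 := by
  have hU := (integrable_util T U hUmeas hUbdd ℓ h hA).2
  have hP : IntegrableOn (fun x => π (h x) * ℓ x) (Set.Icc (0 : ℝ) 1) := by
    simpa only [mul_comm] using integrable_weight T ℓ h hA π
  refine ⟨hU.sub hP, ?_⟩
  rw [integral_sub hU hP]
  congr 1
  simp_rw [← integral_const_mul]
  rw [← integral_finsetSum]
  · congr 1
    ext x
    rw [hπ, Finset.sum_mul]
    exact Finset.sum_congr rfl fun t _ => by ring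
  · intro t _
    exact (integrable_weight T ℓ h hA (fun j => max ((j : ℝ) + 1 - (t : ℝ)) 0)).const_mul _

/-- Theorem 6: existence of an efficient competitive equilibrium. Given a
welfare-maximizing feasible allocation `(ℓ*, h*)` and nonnegative Lagrange
multipliers `λ` satisfying the Lagrangian maximization property over the
attainable set `G` and complementary slackness, the prices
`π_h = ∑_t λ_t [h+1−t]_+` sustain a competitive equilibrium: (i) almost every
consumer maximizes net benefit at `(ℓ*(x), h*(x))`; (ii) the bundle
`L_h = ∫_0^1 ℓ*(x) 1{h*(x)=h} dx` is feasible and maximizes supplier revenue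
over all feasible bundles; (iii) the market clears. -/
theorem efficient_competitive_equilibrium (T : ℕ) (hT : 1 ≤ T)
    (U : ℝ → ℝ → ℕ → ℝ)
    (hUmeas : ∀ k : ℕ, Measurable fun q : ℝ × ℝ => U q.1 q.2 k)
    (hUbdd : ∃ C : ℝ, ∀ (x l : ℝ) (k : ℕ), |U x l k| ≤ C)
    (hU0 : ∀ x : ℝ, U x 0 0 = 0)
    (p : ℕ → ℝ)
    (hpmono : ∀ s t : ℕ, 1 ≤ s → s ≤ t → t ≤ T → p t ≤ p s)
    (hpnonneg : ∀ t ∈ Finset.Icc 1 T, 0 ≤ p t)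
    (G : Set (ℝ × (ℕ → ℝ)))
    (hG : G = {z : ℝ × (ℕ → ℝ) | ∃ ℓ : ℝ → ℝ, ∃ h : ℝ → ℕ,
      IsAllocation T ℓ h ∧
      z.1 = ∫ x in Set.Icc (0 : ℝ) 1, U x (ℓ x) (h x) ∧
      ∀ t : ℕ, z.2 t =
        ∫ x in Set.Icc (0 : ℝ) 1, ℓ x * max ((h x : ℝ) + 1 - (t : ℝ)) 0})
    (ℓstar : ℝ → ℝ) (hstar : ℝ → ℕ)
    (hfeas : FeasibleAllocation T ℓstar hstar p)
    (hopt : ∀ ℓ : ℝ → ℝ, ∀ h : ℝ → ℕ, FeasibleAllocation T ℓ h p →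
      (∫ x in Set.Icc (0 : ℝ) 1, U x (ℓ x) (h x))
        ≤ ∫ x in Set.Icc (0 : ℝ) 1, U x (ℓstar x) (hstar x))
    (zstar : ℝ × (ℕ → ℝ))
    (hzstar₀ : zstar.1 = ∫ x in Set.Icc (0 : ℝ) 1, U x (ℓstar x) (hstar x))
    (hzstar : ∀ t : ℕ, zstar.2 t =
      ∫ x in Set.Icc (0 : ℝ) 1, ℓstar x * max ((hstar x : ℝ) + 1 - (t : ℝ)) 0)
    (lam : ℕ → ℝ)
    (hlam : ∀ t ∈ Finset.Icc 1 T, 0 ≤ lam t)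
    (hlagr : ∀ z ∈ G, z.1 - ∑ t ∈ Finset.Icc 1 T, lam t * z.2 t
      ≤ zstar.1 - ∑ t ∈ Finset.Icc 1 T, lam t * zstar.2 t)
    (hcs : ∀ t ∈ Finset.Icc 1 T,
      lam t * (zstar.2 t - ∑ i ∈ Finset.Icc t T, p i) = 0)
    (π : ℕ → ℝ)
    (hπ : ∀ k : ℕ, π k = ∑ t ∈ Finset.Icc 1 T, lam t * max ((k : ℝ) + 1 - (t : ℝ)) 0)
    (L : ℕ → ℝ)
    (hLdef : ∀ k : ℕ, L k =
      ∫ x in Set.Icc (0 : ℝ) 1, ℓstar x * (if hstar x = k then (1 : ℝ) else 0)) :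
    -- (i) consumer welfare maximization
    (∀ᵐ x ∂(volume.restrict (Set.Icc (0 : ℝ) 1)),
      ∀ l : ℝ, 0 ≤ l → ∀ k ∈ Finset.Icc 1 T,
        U x l k - π k * l ≤ U x (ℓstar x) (hstar x) - π (hstar x) * ℓstar x) ∧
    -- (ii) supplier revenue maximization: the market-clearing bundle is
    -- feasible and maximizes revenue over all feasible bundles
    (FeasibleBundle T L p ∧
      ∀ L' : ℕ → ℝ, FeasibleBundle T L' p →
        ∑ k ∈ Finset.Icc 1 T, L' k * π k ≤ ∑ k ∈ Finset.Icc 1 T, L k * π k) ∧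
    -- (iii) market clearing
    (∀ k ∈ Finset.Icc 1 T, L k =
      ∫ x in Set.Icc (0 : ℝ) 1, ℓstar x * (if hstar x = k then (1 : ℝ) else 0)) := by
  have hA := hfeas.1
  have hLw : ∀ w : ℕ → ℝ, ∫ x in Set.Icc (0 : ℝ) 1, ℓstar x * w (hstar x) =
      ∑ k ∈ Finset.Icc 1 T, L k * w k := by
    intro w
    rw [integral_weight T ℓstar hstar hA w]
    exact Finset.sum_congr rfl fun k _ => by rw [hLdef]
  have hz : ∀ t, zstar.2 t = ∑ k ∈ Finset.Icc 1 T, L k * max ((k : ℝ) + 1 - (t : ℝ)) 0 := by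
    intro t
    rw [hzstar]
    exact hLw (fun k => max ((k : ℝ) + 1 - (t : ℝ)) 0)
  have hrev : ∀ M : ℕ → ℝ, ∑ k ∈ Finset.Icc 1 T, M k * π k =
      ∑ t ∈ Finset.Icc 1 T, lam t *
        ∑ k ∈ Finset.Icc 1 T, M k * max ((k : ℝ) + 1 - (t : ℝ)) 0 := by
    intro M
    simp_rw [hπ, Finset.mul_sum]
    rw [Finset.sum_comm]
    exact Finset.sum_congr rfl fun t _ => Finset.sum_congr rfl fun k _ => by ring
  refine ⟨?_, ⟨⟨?_, ?_⟩, ?_⟩, fun k _ => hLdef k⟩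
  · -- consumers
    obtain ⟨hUs, -⟩ := integrable_util T U hUmeas hUbdd ℓstar hstar hA
    obtain ⟨hFi, hFe⟩ := lagrangian_eq T U hUmeas hUbdd lam π hπ ℓstar hstar hA
    have hVm : Measurable (fun x => U x (ℓstar x) (hstar x) - π (hstar x) * ℓstar x) :=
      hUs.sub (((measurable_from_top (f := π)).comp hA.2.1).mul hA.1)
    set V : ℝ → ℝ := fun x => U x (ℓstar x) (hstar x) - π (hstar x) * ℓstar x with hV
    set μ : Measure ℝ := volume.restrict (Set.Icc (0 : ℝ) 1) with hμ
    suffices hk : ∀ k ∈ Finset.Icc 1 T, ∀ᵐ x ∂μ, ∀ l : ℝ, 0 ≤ l → U x l k - π k * l ≤ V x by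
      have := (Finset.eventually_all (Finset.Icc 1 T)).2 hk
      filter_upwards [this] with x hx l hl k hk
      exact hx k hk l hl
    intro k hk
    by_contra hne
    let B : Set (ℝ × ℝ) := {q | 0 ≤ q.2 ∧ V q.1 < U q.1 q.2 k - π k * q.2}
    have hBm : MeasurableSet B :=
      (measurableSet_le measurable_const measurable_snd).inter
        (measurableSet_lt (hVm.comp measurable_fst)
          ((hUmeas k).sub (measurable_const.mul measurable_snd)))
    have hBpos : μ (Prod.fst '' B) ≠ 0 := by
      intro h0
      apply hne
      rw [ae_iff]
      refine measure_mono_null ?_ h0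
      intro x hx
      simp only [Set.mem_ofPred_eq, not_forall, not_le] at hx
      obtain ⟨l, hl, hlt⟩ := hx
      exact ⟨(x, l), ⟨hl, hlt⟩, rfl⟩
    have : IsFiniteMeasure μ := by rw [hμ]; infer_instance
    obtain ⟨K, hKB, hKc, hKpos⟩ := exists_compact_proj_pos μ B hBm hBpos
    obtain ⟨s, hsm, hs⟩ := exists_selection K hKc
    set P : Set ℝ := Prod.fst '' K with hP
    have hPm : MeasurableSet P := (hKc.image continuous_fst).measurableSet
    classical
    let ℓ : ℝ → ℝ := fun x => if x ∈ P then s x else ℓstar x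
    let h : ℝ → ℕ := fun x => if x ∈ P then k else hstar x
    obtain ⟨R, hR⟩ := (hKc.image continuous_snd).isBounded.exists_norm_le
    have hℓm : Measurable ℓ := Measurable.ite hPm hsm hA.1
    have hA' : IsAllocation T ℓ h := by
      refine ⟨hℓm, Measurable.ite hPm measurable_const hA.2.1, ?_, ?_, ?_⟩
      · intro x
        by_cases hx : x ∈ P
        · simp only [ℓ, if_pos hx]; exact (hKB (hs x hx)).1
        · simp only [ℓ, if_neg hx]; exact hA.2.2.1 x
      · have hdom : Integrable (fun x => |R| + ℓstar x) μ :=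
          (integrable_const _).add hA.2.2.2.1
        refine Integrable.mono' hdom hℓm.aestronglyMeasurable
          (Filter.Eventually.of_forall fun x => ?_)
        have h0 := hA.2.2.1 x
        by_cases hx : x ∈ P
        · simp only [ℓ, if_pos hx]
          have := hR (s x) ⟨(x, s x), hs x hx, rfl⟩
          linarith [le_abs_self R]
        · simp only [ℓ, if_neg hx, Real.norm_eq_abs, abs_of_nonneg h0]
          linarith [abs_nonneg R]
      · intro x
        by_cases hx : x ∈ P
        · simp only [h, if_pos hx]; exact hk
        · simp only [h, if_neg hx]; exact hA.2.2.2.2 x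
    obtain ⟨hWi, hWe⟩ := lagrangian_eq T U hUmeas hUbdd lam π hπ ℓ h hA'
    set W : ℝ → ℝ := fun x => U x (ℓ x) (h x) - π (h x) * ℓ x with hW
    have hWV : ∀ x ∈ P, V x < W x := by
      intro x hx
      have := (hKB (hs x hx)).2
      simpa only [hW, ℓ, h, if_pos hx] using this
    have hWV' : ∀ x ∉ P, W x = V x := by
      intro x hx
      simp only [hW, hV, ℓ, h, if_neg hx]
    have hle : ∫ x, W x ∂μ ≤ ∫ x, V x ∂μ := by
      have := hlagr (∫ x in Set.Icc (0 : ℝ) 1, U x (ℓ x) (h x),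
        fun t => ∫ x in Set.Icc (0 : ℝ) 1, ℓ x * max ((h x : ℝ) + 1 - (t : ℝ)) 0)
        (by rw [hG]; exact ⟨ℓ, h, hA', rfl, fun t => rfl⟩)
      simp only [hzstar₀, hzstar] at this
      rw [hWe, hFe]
      exact this
    have hpos : 0 < ∫ x, (W x - V x) ∂μ := by
      refine (integral_pos_iff_support_of_nonneg (f := fun x => W x - V x) (μ := μ) ?_
        (Integrable.sub hWi hFi)).2 ?_
      rotate_left
      · refine lt_of_lt_of_le (pos_iff_ne_zero.2 hKpos) (measure_mono ?_)
        intro x hx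
        exact (sub_pos.2 (hWV x hx)).ne'
      · intro x
        by_cases hx : x ∈ P
        · exact (sub_pos.2 (hWV x hx)).le
        · simp [hWV' x hx]
    rw [integral_sub hWi hFi] at hpos
    linarith
  · intro k _
    rw [hLdef]
    refine integral_nonneg fun x => mul_nonneg (hA.2.2.1 x) ?_
    split_ifs <;> norm_num
  · intro t ht
    refine le_trans (le_of_eq ?_) (hfeas.2 t ht)
    apply Finset.sum_congr rfl
    intro i hi
    have hi1 : 1 ≤ i := (Finset.mem_Icc.1 ht).1.trans (Finset.mem_Icc.1 hi).1
    rw [hLw (fun j => if i ≤ j then (1 : ℝ) else 0)]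
    rw [← Finset.sum_subset (Finset.Icc_subset_Icc_left hi1)]
    · exact Finset.sum_congr rfl fun k hk => by simp [(Finset.mem_Icc.1 hk).1]
    · intro k hk hk'
      have : ¬ i ≤ k := by
        simp only [Finset.mem_Icc] at hk hk'
        omega
      simp [this]
  · intro L' hL'
    rw [hrev, hrev]
    apply Finset.sum_le_sum
    intro t ht
    have h1 := hL'.2 t ht
    rw [demand_sum T L' t (Finset.mem_Icc.1 ht).1] at h1
    rw [← hz]
    have h2 := mul_le_mul_of_nonneg_left h1 (hlam t ht)
    have h3 := hcs t ht
    linarith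
end

section
/- Willingness to pay has nondecreasing increments in duration (Lemma 2, part 1): let U : ℝ_{>0} × {1,…,T} → ℝ be a utility function with nondecreasing increments in h, i.e. U(ℓ, h+1) − U(ℓ, h) ≥ U(ℓ, h) − U(ℓ, h−1) for all ℓ > 0 and 1 ≤ h ≤ T−1. Fix a surplus level H and define the willingness to pay π(h, H) = sup_{ℓ > 0} (U(ℓ, h) − H)/ℓ, assumed finite and attained for the relevant durations. Then for every h with 2 ≤ h ≤ T−1, π(h, H) ≤ ( π(h+1, H) + π(h−1, H) ) / 2; i.e., h ↦ π(h, H) has nondecreasing increments. Moreover, if U(ℓ, h) is strictly increasing in h for every ℓ > 0, then π(h, H) is strictly increasing in h on its domain. -/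
/-- Lemma 2, part 1: the willingness to pay `π(h,H) = max_{ℓ>0} (U(ℓ,h) − H)/ℓ`
(assumed finite and attained) has nondecreasing increments in the duration `h`
whenever the utility `U` has nondecreasing increments in `h`; moreover, if
`U(ℓ,·)` is strictly increasing in `h` for every `ℓ > 0`, then `π(·,H)` is
strictly increasing in `h`. -/
theorem wtp_nondecreasing_increments (T : ℕ) (hT : 1 ≤ T)
    (U : ℝ → ℕ → ℝ) (H : ℝ)
    (hincr : ∀ ℓ : ℝ, 0 < ℓ → ∀ k : ℕ, 1 ≤ k → k + 1 ≤ T →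
      U ℓ k - U ℓ (k - 1) ≤ U ℓ (k + 1) - U ℓ k)
    (π : ℕ → ℝ)
    (hπ : ∀ h ∈ Finset.Icc 1 T,
      IsGreatest {r : ℝ | ∃ ℓ : ℝ, 0 < ℓ ∧ r = (U ℓ h - H) / ℓ} (π h)) :
    (∀ h : ℕ, 2 ≤ h → h + 1 ≤ T → π h ≤ (π (h + 1) + π (h - 1)) / 2) ∧
    ((∀ ℓ : ℝ, 0 < ℓ → ∀ k : ℕ, 1 ≤ k → k + 1 ≤ T → U ℓ k < U ℓ (k + 1)) →
      ∀ h : ℕ, 1 ≤ h → h + 1 ≤ T → π h < π (h + 1)) := by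
  constructor
  · intro h h2 hhT
    obtain ⟨l, hl, he⟩ := (hπ h (Finset.mem_Icc.2 ⟨by omega, by omega⟩)).1
    have h1 : (U l (h + 1) - H) / l ≤ π (h + 1) :=
      (hπ (h + 1) (Finset.mem_Icc.2 ⟨by omega, hhT⟩)).2 ⟨l, hl, rfl⟩
    have h3 : (U l (h - 1) - H) / l ≤ π (h - 1) :=
      (hπ (h - 1) (Finset.mem_Icc.2 ⟨by omega, by omega⟩)).2 ⟨l, hl, rfl⟩
    have h4 := hincr l hl h (by omega) hhT
    rw [div_le_iff₀ hl] at h1 h3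
    rw [he, div_le_iff₀ hl]
    linarith
  · intro hs h h1 hhT
    obtain ⟨l, hl, he⟩ := (hπ h (Finset.mem_Icc.2 ⟨by omega, by omega⟩)).1
    have h2 : (U l (h + 1) - H) / l ≤ π (h + 1) :=
      (hπ (h + 1) (Finset.mem_Icc.2 ⟨by omega, hhT⟩)).2 ⟨l, hl, rfl⟩
    refine lt_of_lt_of_le ?_ h2
    rw [he]
    exact div_lt_div_of_pos_right (by linarith [hs l hl h h1 hhT]) hl
end
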